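/- arXiv:0902.1729 — 4 statements merged into one kernel-verified Lean document; each statement's English description precedes it below -/
import Mathlib

section
/- Let p be a prime, q = p^r with r ≥ 1, m ≥ 2, and let k be an integer with k ≥ 0 and (k−1)² < q^m. Then the set of vectors ( Tr(f(x)) )_{x ∈ 𝔽_{q^m}}, as f ranges over all polynomials in 𝔽_{q^m}[z] of degree at most k, is an 𝔽_q-linear subspace of 𝔽_q^{q^m} whose dimension over 𝔽_q equals m(k − ⌊k/q⌋) + 1. -/
open Polynomial

lemma aux_bound (q m k i : ℕ) (hq : 2 ≤ q) (hm : 2 ≤ m)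
    (hk : ((k : ℤ) - 1) ^ 2 < (q : ℤ) ^ m) (hi : i ≤ k) (hqi : ¬ q ∣ i) :
    i < q ^ (m - m / 2) := by
  by_contra hcon
  push Not at hcon
  have hd : q ∣ q ^ (m - m / 2) := dvd_pow_self q (by omega)
  have hne : i ≠ q ^ (m - m / 2) := fun h => hqi (h ▸ hd)
  have h1 : q ^ (m - m / 2) + 1 ≤ k := by omega
  have h2 : ((q : ℤ) ^ (m - m / 2)) ≤ (k : ℤ) - 1 := by
    have : ((q ^ (m - m / 2) + 1 : ℕ) : ℤ) ≤ k := by exact_mod_cast h1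
    push_cast at this
    linarith
  have h3 : ((q : ℤ) ^ (m - m / 2)) ^ 2 ≤ ((k : ℤ) - 1) ^ 2 :=
    pow_le_pow_left₀ (by positivity) h2 2
  rw [← pow_mul] at h3
  have h4 : (q : ℤ) ^ m ≤ (q : ℤ) ^ ((m - m / 2) * 2) :=
    pow_le_pow_right₀ (by exact_mod_cast (by omega : 1 ≤ q)) (by omega)
  linarith

lemma aux_mul_lt (q m i a : ℕ) (hq : 2 ≤ q) (hm : 2 ≤ m)
    (hi : i < q ^ (m - m / 2)) (ha : a ≤ m / 2) : q ^ a * i < q ^ m - 1 := by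
  have h1 : q ^ a * i ≤ q ^ (m / 2) * i :=
    Nat.mul_le_mul_right _ (Nat.pow_le_pow_right (by omega) ha)
  have h2 : q ^ (m / 2) * (i + 1) ≤ q ^ (m / 2) * q ^ (m - m / 2) := Nat.mul_le_mul_left _ hi
  rw [← pow_add, show m / 2 + (m - m / 2) = m by omega, mul_add, mul_one] at h2
  have h3 : q ^ 1 ≤ q ^ (m / 2) := Nat.pow_le_pow_right (by omega) (by omega)
  rw [pow_one] at h3
  omega

lemma aux_cong (q m i j a : ℕ) (hq : 2 ≤ q) (hm : 2 ≤ m)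
    (hi : i < q ^ (m - m / 2)) (hj : j < q ^ (m - m / 2)) (hqi : ¬ q ∣ i) (hqj : ¬ q ∣ j)
    (ha : a < m) (h : (q ^ a * i) % (q ^ m - 1) = j) : a = 0 ∧ i = j := by
  rcases Nat.lt_or_ge (m / 2) a with hlt | hge
  · exfalso
    have hb := aux_mul_lt q m j (m - a) hq hm hj (by omega)
    have hi' := aux_mul_lt q m i 0 hq hm hi (by omega)
    rw [pow_zero, one_mul] at hi'
    have h1 : q ^ a * i ≡ j [MOD (q ^ m - 1)] := by
      rw [← h]; exact (Nat.mod_modEq _ _).symm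
    have h2 : q ^ (m - a) * (q ^ a * i) ≡ q ^ (m - a) * j [MOD (q ^ m - 1)] := h1.mul_left _
    rw [← mul_assoc, ← pow_add, show m - a + a = m by omega] at h2
    have h3 : q ^ m ≡ 1 [MOD (q ^ m - 1)] :=
      ((Nat.modEq_iff_dvd' (Nat.one_le_pow _ _ (by omega))).2 dvd_rfl).symm
    have h4 : i ≡ q ^ (m - a) * j [MOD (q ^ m - 1)] := by
      have := (h3.mul_right i).symm.trans h2
      rwa [one_mul] at this
    have h5 := Nat.ModEq.eq_of_lt_of_lt h4 hi' hb
    apply hqi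
    rw [h5]
    exact Dvd.dvd.mul_right (dvd_pow_self q (by omega)) _
  · rw [Nat.mod_eq_of_lt (aux_mul_lt q m i a hq hm hi hge)] at h
    have ha0 : a = 0 := by
      by_contra hne
      apply hqj
      rw [← h]
      exact Dvd.dvd.mul_right (dvd_pow_self q hne) _
    subst ha0
    simpa using h

section
variable (F K : Type) [Field F] [Field K] [Algebra F K]

/-- The map `(c, b) ↦ (∑ Tr (c_i x^i) + b)_x`. -/
noncomputable def auxMap (S : Finset ℕ) : ((S → K) × F) →ₗ[F] (K → F) where
  toFun cb x := ∑ i : S, Algebra.trace F K (cb.1 i * x ^ (i : ℕ)) + cb.2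
  map_add' a b := by
    funext x
    simp only [Prod.fst_add, Prod.snd_add, Pi.add_apply, add_mul, map_add, Finset.sum_add_distrib]
    ring
  map_smul' a b := by
    funext x
    simp [Finset.mul_sum, mul_add]

end

lemma aux_inj (F K : Type) [Field F] [Field K] [Algebra F K] [Fintype F] [Fintype K]
    (q m : ℕ) (hq : 2 ≤ q) (hm : 2 ≤ m) (hF : Fintype.card F = q) (hK : Fintype.card K = q ^ m)
    (hfin : Module.finrank F K = m)
    (S : Finset ℕ) (hS : ∀ i ∈ S, i < q ^ (m - m / 2) ∧ ¬ q ∣ i) :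
    Function.Injective (auxMap F K S) := by
  classical
  rw [injective_iff_map_eq_zero]
  rintro ⟨c, b⟩ h0
  have h0' : ∀ x : K, ∑ i : S, Algebra.trace F K (c i * x ^ (i : ℕ)) + b = 0 :=
    fun x => congrFun h0 x
  have hqm : 2 ≤ q ^ m - 1 := by
    have := Nat.pow_le_pow_left hq m
    have := Nat.pow_le_pow_right (n := 2) (by omega) hm
    omega
  let P : K[X] := ∑ i : S, ∑ a ∈ Finset.range m,
      C (c i ^ (q ^ a)) * X ^ ((q ^ a * (i : ℕ)) % (q ^ m - 1)) + C (algebraMap F K b)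
  have hP : P = 0 := by
    apply eq_zero_of_natDegree_lt_card_of_eval_eq_zero (ι := Kˣ) P (f := fun u => (u : K))
      Units.val_injective
    · intro u
      have h1 := congrArg (algebraMap F K) (h0' (u : K))
      rw [map_add, map_sum, map_zero] at h1
      rw [← h1]
      simp only [P, eval_add, eval_finset_sum, eval_mul, eval_C, eval_pow, eval_X]
      congr 1
      refine Finset.sum_congr rfl fun i _ => ?_
      rw [FiniteField.algebraMap_trace_eq_sum_pow, hfin, Nat.card_eq_fintype_card, hF]
      refine Finset.sum_congr rfl fun a _ => ?_
      rw [mul_pow, ← pow_mul, mul_comm (i : ℕ)]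
      congr 1
      have hu : (u : K) ^ (q ^ m - 1) = 1 := by
        rw [← hK]; exact FiniteField.pow_card_sub_one_eq_one _ u.ne_zero
      exact (pow_eq_pow_mod _ hu).symm
    · rw [Fintype.card_units, hK]
      have : P.natDegree ≤ q ^ m - 2 := by
        refine natDegree_add_le_of_degree_le ?_ (by simp)
        refine natDegree_sum_le_of_forall_le _ _ fun i _ => ?_
        refine natDegree_sum_le_of_forall_le _ _ fun a _ => ?_
        refine (natDegree_C_mul_X_pow_le _ _).trans ?_
        have := Nat.mod_lt (q ^ a * (i : ℕ)) (by omega : 0 < q ^ m - 1)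
        omega
      omega
  have hc : c = 0 := by
    funext j
    have hj := hS j j.2
    have hj0 : (j : ℕ) ≠ 0 := fun h => hj.2 (h ▸ dvd_zero q)
    have h1 : P.coeff j = 0 := by rw [hP, coeff_zero]
    simp only [P, coeff_add, finset_sum_coeff, coeff_C_mul, coeff_X_pow, coeff_C, if_neg hj0,
      add_zero] at h1
    rw [Finset.sum_eq_single j, Finset.sum_eq_single 0] at h1
    · have hjlt := aux_mul_lt q m j 0 hq hm hj.1 (by omega)
      rw [Nat.mod_eq_of_lt hjlt] at h1
      simpa using h1
    · intro a ha ha0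
      rw [if_neg, mul_zero]
      intro h
      exact ha0 (aux_cong q m j j a hq hm hj.1 hj.1 hj.2 hj.2 (Finset.mem_range.1 ha) h.symm).1
    · intro h
      exact absurd (Finset.mem_range.2 (by omega)) h
    · intro i _ hij
      refine Finset.sum_eq_zero fun a ha => ?_
      rw [if_neg, mul_zero]
      intro h
      have hi := hS i i.2
      exact hij (Subtype.ext
        (aux_cong q m i j a hq hm hi.1 hj.1 hi.2 hj.2 (Finset.mem_range.1 ha) h.symm).2)
    · intro h
      exact absurd (Finset.mem_univ _) h
  subst hc
  have := h0' 0
  simp at this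
  simp [this]

lemma aux_range (F K : Type) [Field F] [Field K] [Algebra F K] [Fintype F] [Fintype K]
    (q k : ℕ) (hq : 2 ≤ q) (hF : Fintype.card F = q)
    (S : Finset ℕ) (hS : ∀ i, i ∈ S ↔ 0 < i ∧ i ≤ k ∧ ¬ q ∣ i) :
    (LinearMap.range (auxMap F K S) : Set (K → F)) =
        {v : K → F | ∃ f : K[X], f.natDegree ≤ k ∧
          ∀ x : K, v x = Algebra.trace F K (f.eval x)} := by
  classical
  have key : ∀ j, j ≤ k → ∀ c : K,
      (fun x : K => Algebra.trace F K (c * x ^ j)) ∈ LinearMap.range (auxMap F K S) := by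
    intro j
    induction j using Nat.strong_induction_on with
    | _ j ih =>
      intro hj c
      rcases Nat.eq_zero_or_pos j with h0 | hpos
      · subst h0
        refine ⟨(0, Algebra.trace F K c), ?_⟩
        funext x
        simp [auxMap]
      by_cases hd : q ∣ j
      · obtain ⟨j', rfl⟩ := hd
        have hj' : 0 < j' := Nat.pos_of_mul_pos_left hpos
        have hlt : j' < q * j' := by nlinarith
        let e := FiniteField.frobeniusAlgEquivOfAlgebraic F K
        have he : ∀ y, e y = y ^ q := by
          intro y
          rw [← hF]
          rfl
        obtain ⟨d, hd⟩ := e.surjective c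
        have := ih j' hlt (by omega) d
        convert this using 2 with x
        rw [← Algebra.trace_eq_of_algEquiv e (d * x ^ j'), he, ← hd, he]
        ring_nf
      · have hjS : j ∈ S := (hS j).2 ⟨hpos, hj, hd⟩
        refine ⟨(Pi.single ⟨j, hjS⟩ c, 0), ?_⟩
        funext x
        simp only [auxMap, LinearMap.coe_mk, AddHom.coe_mk, add_zero]
        rw [Finset.sum_eq_single ⟨j, hjS⟩]
        · simp
        · intro b _ hb
          simp [Pi.single_eq_of_ne hb]
        · simp
  ext v
  constructor
  · rintro ⟨⟨c, b⟩, rfl⟩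
    obtain ⟨c0, hc0⟩ := Algebra.trace_surjective F K b
    refine ⟨∑ i : S, C (c i) * X ^ (i : ℕ) + C c0, ?_, fun x => ?_⟩
    · refine natDegree_add_le_of_degree_le ?_ (by simp)
      refine natDegree_sum_le_of_forall_le _ _ fun i _ => ?_
      exact (natDegree_C_mul_X_pow_le _ _).trans ((hS i).1 i.2).2.1
    · simp [auxMap, eval_finset_sum, hc0]
  · rintro ⟨f, hf, hv⟩
    have : v = ∑ j ∈ Finset.range (k + 1), fun x : K => Algebra.trace F K (f.coeff j * x ^ j) := by
      funext x
      rw [hv, eval_eq_sum_range' (n := k + 1) (by omega), map_sum, Finset.sum_apply]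
    rw [this]
    exact Submodule.sum_mem _ fun j hj => key j (by have := Finset.mem_range.1 hj; omega) _

/-- For `q = p^r`, `m ≥ 2` and `0 ≤ k` with `(k-1)² < q^m`, the trace code
`{ (Tr(f(x)))_{x ∈ 𝔽_{q^m}} : f ∈ 𝔽_{q^m}[z], deg f ≤ k }` is an `𝔽_q`-subspace of
`𝔽_q^{q^m}` of dimension `m(k - ⌊k/q⌋) + 1`. -/
theorem stmt_0 (p r m : ℕ) (hp : p.Prime) (hr : 1 ≤ r) (hm : 2 ≤ m)
    (F K : Type) [Field F] [Field K] [Algebra F K] [Fintype F] [Fintype K]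
    (hF : Fintype.card F = p ^ r) (hK : Fintype.card K = (p ^ r) ^ m)
    (k : ℕ) (hk : ((k : ℤ) - 1) ^ 2 < ((p : ℤ) ^ r) ^ m) :
    ∃ W : Submodule F (K → F),
      (W : Set (K → F)) =
        {v : K → F | ∃ f : K[X], f.natDegree ≤ k ∧
          ∀ x : K, v x = Algebra.trace F K (f.eval x)} ∧
      Module.finrank F W = m * (k - k / p ^ r) + 1 := by
  classical
  have hq : 2 ≤ p ^ r := hF ▸ Fintype.one_lt_card
  have hfin : Module.finrank F K = m := by
    have h := Module.card_eq_pow_finrank (K := F) (V := K)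
    rw [hF, hK] at h
    exact (Nat.pow_right_injective hq h).symm
  have hk' : ((k : ℤ) - 1) ^ 2 < ((p ^ r : ℕ) : ℤ) ^ m := by exact_mod_cast hk
  generalize p ^ r = q at *
  let S : Finset ℕ := (Finset.Ioc 0 k).filter fun i => ¬ q ∣ i
  have hS : ∀ i, i ∈ S ↔ 0 < i ∧ i ≤ k ∧ ¬ q ∣ i := by
    intro i
    simp [S, and_assoc]
  have hcard : S.card = k - k / q := by
    have h1 := Finset.card_filter_add_card_filter_not (s := Finset.Ioc 0 k) (fun i => q ∣ i)
    rw [Nat.Ioc_filter_dvd_card_eq_div, Nat.card_Ioc] at h1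
    change k / q + S.card = _ at h1
    omega
  refine ⟨LinearMap.range (auxMap F K S), aux_range F K q k hq hF S hS, ?_⟩
  rw [LinearMap.finrank_range_of_inj (aux_inj F K q m hq hm hF hK hfin S ?_),
    Module.finrank_prod, Module.finrank_pi_fintype]
  · simp [hfin, hcard, mul_comm]
  · intro i hi
    have := (hS i).1 hi
    exact ⟨aux_bound q m k i hq hm hk' this.2.1 this.2.2, this.2.2⟩
end

section
/- Let p be a prime, q = p^r with r ≥ 1, m ≥ 2. Let g ∈ 𝔽_{q^m}[z] be a nonconstant polynomial with no zeros in 𝔽_{q^m}, let s be the number of distinct zeros of g in an algebraic closure, and write g = g₁^q · g₂ with g₁, g₂ ∈ 𝔽_{q^m}[z], deg g₁ = r₁, deg g₂ = r₂, where g₂ is q-th power free (no nonconstant polynomial to the q-th power divides g₂). Assume (deg g + 2s − 2)·√(q^m) < q^m + 1. Then the set of vectors ( Tr(h(x)/g(x)) )_{x ∈ 𝔽_{q^m}}, as h ranges over all polynomials in 𝔽_{q^m}[z] of degree strictly less than deg g, is an 𝔽_q-linear subspace of 𝔽_q^{q^m} whose dimension over 𝔽_q equals m((q−1)r₁ + r₂).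 -/
open Polynomial

section Part1
open Polynomial

/-- Weight filtration on `E[X][Y]`: `X` has weight `p`, `Y` has weight `ε`. -/
def WE {E : Type*} [Field E] (p ε : ℕ) (n : ℤ) (u : E[X][X]) : Prop :=
  ∀ j, u.coeff j ≠ 0 → (p : ℤ) * (u.coeff j).natDegree + ε * j ≤ n

section weights
variable {E : Type*} [Field E] {p ε : ℕ}

lemma WE.zero (n : ℤ) : WE p ε n (0 : E[X][X]) := by
  intro j h; simp at h

lemma WE.mono {n k : ℤ} {u : E[X][X]} (h : WE p ε n u) (hk : n ≤ k) : WE p ε k u :=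
  fun j hj => (h j hj).trans hk

lemma WE.add {n : ℤ} {u v : E[X][X]} (hu : WE p ε n u) (hv : WE p ε n v) :
    WE p ε n (u + v) := by
  intro j hj
  rw [coeff_add] at hj ⊢
  by_cases h1 : u.coeff j = 0
  · rw [h1, zero_add] at hj ⊢; exact hv j hj
  by_cases h2 : v.coeff j = 0
  · rw [h2, add_zero] at hj ⊢; exact hu j hj
  have := natDegree_add_le (u.coeff j) (v.coeff j)
  have a1 := hu j h1
  have a2 := hv j h2
  rcases le_max_iff.1 this with h | h
  · have : (p : ℤ) * (u.coeff j + v.coeff j).natDegree ≤ p * (u.coeff j).natDegree := by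
      gcongr
    linarith
  · have : (p : ℤ) * (u.coeff j + v.coeff j).natDegree ≤ p * (v.coeff j).natDegree := by
      gcongr
    linarith

lemma WE.neg {n : ℤ} {u : E[X][X]} (hu : WE p ε n u) : WE p ε n (-u) := by
  intro j hj
  rw [coeff_neg] at hj ⊢
  rw [natDegree_neg]
  exact hu j (by simpa using hj)

lemma WE.sub {n : ℤ} {u v : E[X][X]} (hu : WE p ε n u) (hv : WE p ε n v) :
    WE p ε n (u - v) := by
  rw [sub_eq_add_neg]; exact hu.add hv.neg

lemma WE.sum {ι : Type*} {n : ℤ} (s : Finset ι) (f : ι → E[X][X])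
    (h : ∀ i ∈ s, WE p ε n (f i)) : WE p ε n (∑ i ∈ s, f i) := by
  classical
  induction s using Finset.induction_on with
  | empty => simpa using WE.zero n
  | insert a s ha ih =>
    rw [Finset.sum_insert ha]
    exact (h a (by simp)).add (ih fun i hi => h i (by simp [hi]))

lemma WE.mulC {n : ℤ} {u : E[X][X]} (hu : WE p ε n u) (b : E[X]) :
    WE p ε (n + p * b.natDegree) (C b * u) := by
  intro j hj
  rw [coeff_C_mul] at hj ⊢
  have := hu j (right_ne_zero_of_mul hj)
  have h2 : (p : ℤ) * (b * u.coeff j).natDegree ≤ p * (b.natDegree + (u.coeff j).natDegree) := by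
    have := natDegree_mul_le (p := b) (q := u.coeff j)
    gcongr
    exact_mod_cast this
  linarith

lemma WE.mulY {n : ℤ} {u : E[X][X]} (hu : WE p ε n u) :
    WE p ε (n + ε) (X * u) := by
  intro j hj
  cases j with
  | zero => simp at hj
  | succ j =>
    rw [coeff_X_mul] at hj ⊢
    have := hu j hj
    push_cast
    linarith

lemma WE.mon (b : E[X]) (j : ℕ) :
    WE p ε (p * b.natDegree + ε * j) (C b * X ^ j : E[X][X]) := by
  intro i hi
  rw [coeff_C_mul, coeff_X_pow] at hi ⊢
  split_ifs at hi ⊢ with h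
  · subst h; simp
  · simp at hi

end weights

section red
variable {E : Type*} [Field E] {p ε : ℕ} (a H : E[X])

/-- The Artin–Schreier-type polynomial. -/
noncomputable def MM (p : ℕ) (a H : E[X]) : E[X][X] := X ^ p - (C a * X + C H)

lemma MM_monic (hp : 2 ≤ p) : (MM p a H).Monic := by
  apply monic_X_pow_sub
  have := degree_linear_le (a := a) (b := H)
  exact this.trans_lt (by exact_mod_cast hp)

lemma MM_degree (hp : 2 ≤ p) : (MM p a H).degree = p := by
  unfold MM
  rw [degree_sub_eq_left_of_degree_lt]
  · simp
  · have := degree_linear_le (a := a) (b := H)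
    rw [degree_X_pow]
    exact this.trans_lt (by exact_mod_cast hp)

lemma mod_eq_self (hp : 2 ≤ p) {u : E[X][X]} (hu : u.degree < p) : u %ₘ MM p a H = u := by
  rw [(modByMonic_eq_self_iff (MM_monic a H hp)).2]
  rwa [MM_degree a H hp]

lemma mod_degree (hp : 2 ≤ p) (u : E[X][X]) : (u %ₘ MM p a H).degree < p := by
  have := degree_modByMonic_lt u (MM_monic a H hp)
  rwa [MM_degree a H hp] at this

lemma Cmul_mod (hp : 2 ≤ p) (b : E[X]) (u : E[X][X]) :
    (C b * u) %ₘ MM p a H = C b * (u %ₘ MM p a H) := by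
  rw [← smul_eq_C_mul, ← smul_eq_C_mul, smul_modByMonic]

lemma mul_mod_mod (hp : 2 ≤ p) (u v : E[X][X]) :
    (u * (v %ₘ MM p a H)) %ₘ MM p a H = (u * v) %ₘ MM p a H := by
  have hM := MM_monic a H hp
  rw [modByMonic_eq_of_dvd_sub hM]
  rw [← mul_sub]
  have := modByMonic_add_div v (MM p a H)
  refine Dvd.dvd.mul_left ⟨-(v /ₘ MM p a H), ?_⟩ u
  linear_combination this

lemma Yp_mod (hp : 2 ≤ p) : (X ^ p : E[X][X]) %ₘ MM p a H = C a * X + C H := by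
  have hM := MM_monic a H hp
  rw [← mod_eq_self a H hp (u := C a * X + C H)]
  · apply modByMonic_eq_of_dvd_sub hM
    unfold MM; exact dvd_rfl
  · exact degree_linear_le.trans_lt (by exact_mod_cast hp)

lemma Yp_WE (hp : 2 ≤ p) (hH : H.natDegree = ε)
    (ha : p * a.natDegree + ε < p * ε) : WE p ε (p * ε) ((X ^ p : E[X][X]) %ₘ MM p a H) := by
  rw [Yp_mod a H hp]
  apply WE.add
  · have := WE.mon (p := p) (ε := ε) a 1
    rw [pow_one] at this
    apply this.mono
    have : (p * a.natDegree + ε : ℤ) < p * ε := by exact_mod_cast ha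
    push_cast; linarith
  · have := WE.mon (p := p) (ε := ε) H 0
    rw [pow_zero, mul_one] at this
    apply this.mono
    rw [hH]; simp

lemma mulY_mod (hp : 2 ≤ p) (hH : H.natDegree = ε)
    (ha : p * a.natDegree + ε < p * ε) {n : ℤ} {w : E[X][X]} (hw : WE p ε n w) (hd : w.degree < p) :
    WE p ε (n + ε) ((X * w) %ₘ MM p a H) := by
  obtain ⟨k, rfl⟩ : ∃ k, p = k + 1 := ⟨p - 1, by omega⟩
  set b := w.coeff k with hb
  have e1 : w = (w - C b * X ^ k) + C b * X ^ k := by ring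
  have hd' : (w - C b * X ^ k).degree < (k : WithBot ℕ) := by
    rw [degree_lt_iff_coeff_zero]
    intro m hm
    rcases hm.eq_or_lt with h | h
    · subst h; simp [hb]
    · have : w.coeff m = 0 := coeff_eq_zero_of_degree_lt (hd.trans_le (by exact_mod_cast h))
      rw [coeff_sub, this, coeff_C_mul, coeff_X_pow, if_neg (by omega)]; simp
  have hbw : WE (k+1) ε n (C b * X ^ k) := by
    intro i hi
    rw [coeff_C_mul, coeff_X_pow] at hi ⊢
    split_ifs at hi ⊢ with h
    · subst h; simp at hi ⊢; simpa using hw i hi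
    · simp at hi
  have e2 : (X * w) %ₘ MM (k+1) a H = X * (w - C b * X ^ k)
      + C b * ((X ^ (k+1)) %ₘ MM (k+1) a H) := by
    conv_lhs => rw [e1]
    rw [mul_add, add_modByMonic, mod_eq_self a H hp, show (X : E[X][X]) * (C b * X ^ k) =
      C b * X ^ (k+1) by ring, Cmul_mod a H hp]
    rw [mul_comm, degree_mul_X]
    have := Order.succ_le_of_lt hd'
    push_cast
    exact WithBot.add_lt_add_right (by simp) hd'
  rw [e2]
  apply WE.add
  · exact (hw.sub hbw).mulY
  · by_cases hb0 : b = 0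
    · rw [hb0]; simp; exact WE.zero _
    · have h1 := hw k hb0
      refine ((Yp_WE a H hp hH ha).mulC b).mono ?_
      push_cast at *
      rw [← hb] at h1
      linarith

lemma lead_Y (hp : 2 ≤ p) (hH : H.natDegree = ε)
    (ha : p * a.natDegree + ε < p * ε) (j : ℕ) : ∃ (κ : E) (i j0 : ℕ), κ ≠ 0 ∧ j0 < p ∧ p * i + ε * j0 = ε * j ∧
    WE p ε (ε * j - 1) ((X ^ j : E[X][X]) %ₘ MM p a H - C (C κ * X ^ i) * X ^ j0) := by
  have hε : 0 < ε := by
    rcases Nat.eq_zero_or_pos ε with h | h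
    · subst h; simp at ha
    · exact h
  induction j with
  | zero =>
    refine ⟨1, 0, 0, one_ne_zero, by omega, by simp, ?_⟩
    rw [mod_eq_self a H hp]
    · simp; exact WE.zero _
    · simp; omega
  | succ j ih =>
    obtain ⟨κ, i, j0, hκ, hj0, hw, hWE⟩ := ih
    set w := (X ^ j : E[X][X]) %ₘ MM p a H - C (C κ * X ^ i) * X ^ j0 with hwdef
    have hwd : w.degree < p := by
      apply (degree_sub_le _ _).trans_lt
      apply max_lt (mod_degree a H hp _)
      exact (degree_C_mul_X_pow_le _ _).trans_lt (by exact_mod_cast hj0)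
    have key : (X ^ (j+1) : E[X][X]) %ₘ MM p a H =
        C (C κ * X ^ i) * ((X ^ (j0+1) : E[X][X]) %ₘ MM p a H) + (X * w) %ₘ MM p a H := by
      rw [← Cmul_mod a H hp, ← add_modByMonic, pow_succ' X j, ← mul_mod_mod a H hp]
      congr 1
      rw [hwdef]; ring
    have hXw := mulY_mod a H hp hH ha hWE hwd
    by_cases hlt : j0 + 1 < p
    · refine ⟨κ, i, j0+1, hκ, hlt, by rw [mul_add, mul_add]; omega, ?_⟩
      rw [key, mod_eq_self a H hp (by rw [degree_X_pow]; exact_mod_cast hlt)]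
      rw [add_sub_cancel_left]
      apply hXw.mono
      push_cast; linarith
    · have hj0p : j0 + 1 = p := by omega
      have hi : p * i + ε * p = ε * (j+1) := by
        rw [← hj0p] at hw ⊢; rw [mul_add, mul_add, mul_one]; omega
      refine ⟨κ * H.leadingCoeff, i + ε, 0, ?_, by omega, ?_, ?_⟩
      · apply mul_ne_zero hκ
        intro h
        rw [leadingCoeff_eq_zero] at h
        rw [h] at hH; simp at hH; omega
      · rw [mul_add, ← hi]; ring
      · have e3 : (X ^ (j+1) : E[X][X]) %ₘ MM p a H
            - C (C (κ * H.leadingCoeff) * X ^ (i + ε)) * X ^ 0 =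
            C (C κ * X ^ i) * (C a * X ^ 1) + C (C κ * X ^ i) * (C H.eraseLead * X ^ 0)
            + (X * w) %ₘ MM p a H := by
          rw [key, hj0p, Yp_mod a H hp]
          have : (C H : E[X][X]) = C H.eraseLead + C (C H.leadingCoeff * X ^ ε) := by
            rw [← C_add, ← hH, eraseLead_add_C_mul_X_pow]
          rw [this]
          simp only [map_mul, map_pow, pow_add]
          ring
        rw [e3]
        have hdeg : (C κ * X ^ i : E[X]).natDegree ≤ i := natDegree_C_mul_X_pow_le _ _
        have hiZ : (p * i + ε * p : ℤ) = ε * (j+1) := by exact_mod_cast hi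
        have hdZ : (p * (C κ * X ^ i : E[X]).natDegree : ℤ) ≤ p * i := by
          gcongr
        apply WE.add (WE.add _ _) _
        · refine ((WE.mon a 1).mulC _).mono ?_
          have : (p * a.natDegree + ε : ℤ) < p * ε := by exact_mod_cast ha
          push_cast
          linarith
        · refine ((WE.mon H.eraseLead 0).mulC _).mono ?_
          have h1 : H.eraseLead.natDegree + 1 ≤ ε := by
            have := eraseLead_natDegree_le H
            omega
          have h2 : (p * (H.eraseLead.natDegree + 1) : ℤ) ≤ p * ε := by
            gcongr; exact_mod_cast h1
          have : (2 : ℤ) ≤ p := by exact_mod_cast hp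
          push_cast
          linarith
        · apply hXw.mono; push_cast; linarith

lemma WE_mod_mon (hp : 2 ≤ p) (hH : H.natDegree = ε)
    (ha : p * a.natDegree + ε < p * ε) (b : E[X]) (j : ℕ) :
    WE p ε (p * b.natDegree + ε * j) ((C b * X ^ j : E[X][X]) %ₘ MM p a H) := by
  rw [Cmul_mod a H hp]
  obtain ⟨κ, i, j0, hκ, hj0, hw, hWE⟩ := lead_Y a H hp hH ha j
  have h : WE p ε (ε * j) ((X ^ j : E[X][X]) %ₘ MM p a H) := by
    have e : (X ^ j : E[X][X]) %ₘ MM p a H = ((X ^ j : E[X][X]) %ₘ MM p a H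
      - C (C κ * X ^ i) * X ^ j0) + C (C κ * X ^ i) * X ^ j0 := by ring
    rw [e]
    apply WE.add
    · exact hWE.mono (by linarith)
    · refine (WE.mon _ _).mono ?_
      have hdeg : (C κ * X ^ i : E[X]).natDegree ≤ i := natDegree_C_mul_X_pow_le _ _
      have hdZ : (p * (C κ * X ^ i : E[X]).natDegree : ℤ) ≤ p * i := by gcongr
      have : (p * i + ε * j0 : ℤ) = ε * j := by exact_mod_cast hw
      linarith
  exact (h.mulC b).mono (by linarith)

/-- A sum of monomials with distinct weights is nonzero modulo `MM`. -/
lemma sum_mod_ne_zero (hp : 2 ≤ p) (hH : H.natDegree = ε)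
    (ha : p * a.natDegree + ε < p * ε) {ι : Type*} [Fintype ι] (α : ι → E) (hα : α ≠ 0) (e f : ι → ℕ)
    (hinj : Function.Injective fun t => p * e t + ε * f t) :
    (∑ t, C (C (α t) * X ^ e t) * X ^ f t : E[X][X]) %ₘ MM p a H ≠ 0 := by
  classical
  obtain ⟨t1, ht1⟩ := Function.ne_iff.1 hα
  obtain ⟨t0, ht0, hmax⟩ := Finset.exists_max_image (Finset.univ.filter fun t => α t ≠ 0)
    (fun t => p * e t + ε * f t) ⟨t1, by simpa using ht1⟩
  simp only [Finset.mem_filter, Finset.mem_univ, true_and] at ht0 hmax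
  intro h0
  obtain ⟨κ, i, j0, hκ, hj0, hw, hWE⟩ := lead_Y a H hp hH ha (f t0)
  set n : ℕ := p * e t0 + ε * f t0 with hn
  have hrest : WE p ε (n - 1 : ℤ)
      (∑ t ∈ Finset.univ.erase t0, (C (C (α t) * X ^ e t) * X ^ f t : E[X][X]) %ₘ MM p a H) := by
    apply WE.sum
    intro t ht
    by_cases hat : α t = 0
    · rw [hat]; simp; exact WE.zero _
    · refine (WE_mod_mon a H hp hH ha _ _).mono ?_
      have h1 := hmax t hat
      have h2 : p * e t + ε * f t ≠ n := fun h => (Finset.ne_of_mem_erase ht) (hinj h)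
      have h3 : p * e t + ε * f t + 1 ≤ n := by omega
      have h4 : (p * e t + ε * f t + 1 : ℤ) ≤ n := by exact_mod_cast h3
      have hdeg : (C (α t) * X ^ e t : E[X]).natDegree ≤ e t := natDegree_C_mul_X_pow_le _ _
      have hdZ : (p * (C (α t) * X ^ e t : E[X]).natDegree : ℤ) ≤ p * e t := by gcongr
      linarith
  have hsum : (∑ t, C (C (α t) * X ^ e t) * X ^ f t : E[X][X]) %ₘ MM p a H =
      ∑ t, (C (C (α t) * X ^ e t) * X ^ f t : E[X][X]) %ₘ MM p a H :=
    map_sum (modByMonicHom (MM p a H)) _ _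
  rw [hsum, ← Finset.add_sum_erase _ _ (Finset.mem_univ t0), Cmul_mod a H hp] at h0
  have hA := (hWE.mulC (C (α t0) * X ^ e t0))
  have hB : WE p ε (n - 1 : ℤ) (C (C (α t0 * κ) * X ^ (e t0 + i)) * X ^ j0 : E[X][X]) := by
    have : (C (C (α t0 * κ) * X ^ (e t0 + i)) * X ^ j0 : E[X][X]) =
      -(C (C (α t0) * X ^ e t0) * ((X ^ f t0 : E[X][X]) %ₘ MM p a H - C (C κ * X ^ i) * X ^ j0))
      - (∑ t ∈ Finset.univ.erase t0, (C (C (α t) * X ^ e t) * X ^ f t : E[X][X]) %ₘ MM p a H) := by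
      rw [eq_sub_iff_add_eq, mul_sub, ← sub_eq_zero, ← h0]
      simp only [map_mul, map_pow, pow_add]
      ring
    rw [this]
    refine WE.sub (WE.neg (hA.mono ?_)) hrest
    have hdeg : (C (α t0) * X ^ e t0 : E[X]).natDegree ≤ e t0 := natDegree_C_mul_X_pow_le _ _
    have hdZ : (p * (C (α t0) * X ^ e t0 : E[X]).natDegree : ℤ) ≤ p * e t0 := by gcongr
    rw [hn]; push_cast; linarith
  have hne : α t0 * κ ≠ 0 := mul_ne_zero ht0 hκ
  have := hB j0
  rw [coeff_C_mul, coeff_X_pow, if_pos rfl, mul_one, natDegree_C_mul_X_pow _ _ hne] at this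
  have := this (by simp [ht0, hκ])
  have hwZ : (p * i + ε * j0 : ℤ) = ε * f t0 := by exact_mod_cast hw
  rw [hn] at this
  push_cast at this
  linarith

end red

end Part1

section Part2
open Polynomial

lemma wt_inj {p ε : ℕ} (hp : p.Prime) (hε : ¬ p ∣ ε) {i j i' j' : ℕ} (hj : j < p) (hj' : j' < p)
    (h : p * i + ε * j = p * i' + ε * j') : i = i' ∧ j = j' := by
  have hjj : j = j' := by
    have h1 : (ε * j) ≡ (ε * j') [MOD p] := by
      have : p * i + ε * j ≡ p * i' + ε * j' [MOD p] := by rw [h]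
      simpa [Nat.ModEq, Nat.add_mod] using this
    have h2 := Nat.ModEq.cancel_left_of_coprime ((Nat.Prime.coprime_iff_not_dvd hp).2 hε) h1
    rwa [Nat.ModEq, Nat.mod_eq_of_lt hj, Nat.mod_eq_of_lt hj'] at h2
  subst hjj
  refine ⟨?_, rfl⟩
  have := Nat.add_right_cancel h
  exact Nat.eq_of_mul_eq_mul_left hp.pos this

section step
variable {E : Type*} [Field E] {p ε : ℕ}

lemma eval_MM (a H : E[X]) (z y : E) (hy : y ^ p = a.eval z * y + H.eval z) :
    ((MM p a H).map (evalRingHom z)).eval y = 0 := by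
  unfold MM
  simp [hy]

lemma eval_mod (a H : E[X]) (u : E[X][X]) (z y : E) (hy : y ^ p = a.eval z * y + H.eval z) :
    ((u %ₘ MM p a H).map (evalRingHom z)).eval y = (u.map (evalRingHom z)).eval y := by
  conv_rhs => rw [← modByMonic_add_div u (MM p a H)]
  simp only [Polynomial.map_add, Polynomial.map_mul, eval_add, eval_mul, eval_MM a H z y hy]
  simp

lemma eval_monsum {ι : Type*} [Fintype ι] (α : ι → E) (e f : ι → ℕ) (z y : E) :
    ((∑ t, C (C (α t) * X ^ e t) * X ^ f t : E[X][X]).map (evalRingHom z)).eval y =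
      ∑ t, α t * z ^ e t * y ^ f t := by
  simp [Polynomial.map_sum, eval_finsetSum]

lemma stepanov_aux [Fintype E] [Fact p.Prime] [CharP E p] (l R1 : ℕ)
    (hR : p ^ l = p * R1) (hE : Fintype.card E = (p ^ l) ^ 2)
    (a H : E[X]) (hH : H.natDegree = ε) (ha : p * a.natDegree + ε < p * ε) (hε : ¬ p ∣ ε)
    (hR1 : p * ε + 2 ≤ R1) (Z : Finset E)
    (hZ : ∀ z ∈ Z, ∃ S : Finset E, S.card = p ∧ ∀ y ∈ S, y ^ p = a.eval z * y + H.eval z) :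
    p * Z.card ≤ (p ^ l) ^ 2 + (2 * p * ε + 1) * p ^ l := by
  classical
  have hpp : p.Prime := Fact.out
  have hp : 2 ≤ p := hpp.two_le
  have hε0 : 0 < ε := Nat.pos_of_ne_zero (by rintro rfl; simp at hε)
  set R := p ^ l with hRdef
  have hRpos : 0 < R := by positivity
  obtain ⟨A1, hA1⟩ : ∃ A1, R1 = A1 + 1 + ε := ⟨R1 - ε - 1, by
    have : ε ≤ p * ε := Nat.le_mul_of_pos_left _ (by omega)
    omega⟩
  obtain ⟨A2, hA2⟩ : ∃ A2, R1 + ε = A2 + 1 := ⟨R1 + ε - 1, by omega⟩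
  obtain ⟨k, hk⟩ : ∃ k, p = k + 1 := ⟨p - 1, by omega⟩
  let ι := Fin (A1 + 1) × Fin p × Fin (A2 + 1) × Fin p
  -- exponents
  let eU : ι → ℕ := fun t => t.1 * R + t.2.2.1
  let fU : ι → ℕ := fun t => t.2.1 * R + t.2.2.2
  let eV : ι → ℕ := fun t => t.1 + t.2.2.1 * R
  let fV : ι → ℕ := fun t => t.2.1 + t.2.2.2 * R
  have bnd1 : ∀ i : Fin (A1+1), ∀ j : Fin p, p * i + ε * j ≤ p * A1 + ε * k := by
    intro i j
    have h1 : (i : ℕ) ≤ A1 := by omega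
    have h2 : (j : ℕ) ≤ k := by omega
    gcongr
  have bnd2 : ∀ i : Fin (A2+1), ∀ j : Fin p, p * i + ε * j ≤ p * A2 + ε * k := by
    intro i j
    have h1 : (i : ℕ) ≤ A2 := by omega
    have h2 : (j : ℕ) ≤ k := by omega
    gcongr
  have hsmall : p * A1 + ε * k + (p + ε) = R := by
    rw [hR, hA1, hk]; ring
  set n : ℕ := R * (p * A1 + ε * k) + (p * A2 + ε * k) with hn
  set n' : ℕ := (p * A1 + ε * k) + R * (p * A2 + ε * k) with hn'
  set D : ℕ := n / p + 1 with hD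
  -- linear map
  let Um : (ι → E) → E[X][X] := fun α => ∑ t, C (C (α t) * X ^ eU t) * X ^ fU t
  let Λ : (ι → E) →ₗ[E] (Fin p × Fin D → E) :=
    { toFun := fun α s => ((Um α %ₘ MM p a H).coeff s.1).coeff s.2
      map_add' := by
        intro α β
        funext s
        have : Um (α + β) = Um α + Um β := by
          simp only [Um, ← Finset.sum_add_distrib]
          refine Finset.sum_congr rfl fun t _ => ?_
          simp only [Pi.add_apply, C_add, add_mul]
        simp only [this, add_modByMonic, coeff_add, Pi.add_apply]
      map_smul' := by
        intro c α
        funext s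
        have : Um (c • α) = (C c : E[X]) • Um α := by
          simp only [Um, Finset.smul_sum]
          refine Finset.sum_congr rfl fun t _ => ?_
          simp only [Pi.smul_apply, smul_eq_mul, smul_eq_C_mul, C_mul]
          ring
        simp only [this, smul_modByMonic, coeff_smul, RingHom.id_apply, Pi.smul_apply, smul_eq_mul,
          coeff_C_mul] }
  have hcard : Module.finrank E (Fin p × Fin D → E) < Module.finrank E (ι → E) := by
    rw [Module.finrank_fintype_fun_eq_card, Module.finrank_fintype_fun_eq_card]
    simp only [ι, Fintype.card_prod, Fintype.card_fin]
    have h1 : p * D ≤ n + p := by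
      rw [hD, mul_add, mul_one]
      have := Nat.mul_div_le n p
      omega
    refine h1.trans_lt ?_
    rw [hn, ← hA2]
    have hA2p : p * A2 + p = p * (R1 + ε) := by rw [hA2]; ring
    have hA1p : p * A1 + p = p * (R1 - ε) := by rw [hA1]; simp; ring
    have e1 : (A1 + 1) * (p * ((R1 + ε) * p)) = (p * A1 + p) * (p * (R1 + ε)) := by ring
    rw [e1]
    -- p*A1 + ε*k = R - p - ε
    have z1 : (p * A1 + ε * k : ℤ) = R - p - ε := by
      have : ((p * A1 + ε * k + (p + ε) : ℕ) : ℤ) = R := by exact_mod_cast hsmall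
      push_cast at this; linarith
    have z2 : (p * A2 : ℤ) = p * (R1 + ε) - p := by
      have : ((p * A2 + p : ℕ) : ℤ) = (p * (R1 + ε) : ℕ) := by exact_mod_cast hA2p
      push_cast at this; linarith
    have z3 : (p * A1 + p : ℤ) = p * (R1 - ε) := by
      have : (R1 : ℤ) = A1 + 1 + ε := by exact_mod_cast hA1
      rw [this]; ring
    have z4 : (R : ℤ) = p * R1 := by exact_mod_cast hR
    have z5 : (p : ℤ) = k + 1 := by exact_mod_cast hk
    have z6 : (p * ε + 2 : ℤ) ≤ R1 := by exact_mod_cast hR1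
    have z7 : (2 : ℤ) ≤ p := by exact_mod_cast hp
    have z8 : (1 : ℤ) ≤ ε := by exact_mod_cast hε0
    zify
    rw [z1, z3, z4]
    have z9 : (ε * k : ℤ) = ε * (p - 1) := by rw [z5]; ring
    rw [z2, z9]
    have q1 : (p * ε : ℤ) * (p * ε + 2) ≤ p * ε * R1 := by gcongr
    have q2 : (p : ℤ) * R1 * 2 ≤ p * R1 * p := by gcongr
    have q3 : (0 : ℤ) < p * R1 := by rw [← z4]; exact_mod_cast hRpos
    nlinarith
  have hker := LinearMap.ker_ne_bot_of_finrank_lt (f := Λ) hcard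
  obtain ⟨α, hαker, hα0⟩ := (Submodule.ne_bot_iff _).1 hker
  have hWU : WE p ε n (Um α %ₘ MM p a H) := by
    have : Um α %ₘ MM p a H = ∑ t, (C (C (α t) * X ^ eU t) * X ^ fU t) %ₘ MM p a H :=
      map_sum (modByMonicHom (MM p a H)) _ _
    rw [this]
    apply WE.sum
    intro t _
    refine (WE_mod_mon a H hp hH ha _ _).mono ?_
    have hdeg : (C (α t) * X ^ eU t : E[X]).natDegree ≤ eU t := natDegree_C_mul_X_pow_le _ _
    have : p * (C (α t) * X ^ eU t : E[X]).natDegree + ε * fU t ≤ n := by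
      calc _ ≤ p * eU t + ε * fU t := by gcongr
        _ = R * (p * t.1 + ε * t.2.1) + (p * t.2.2.1 + ε * t.2.2.2) := by
          simp only [eU, fU]; ring
        _ ≤ n := by
          rw [hn]
          have := bnd1 t.1 t.2.1
          have := bnd2 t.2.2.1 t.2.2.2
          gcongr
    exact_mod_cast this
  have hU0 : Um α %ₘ MM p a H = 0 := by
    ext j i
    rw [coeff_zero, coeff_zero]
    by_cases hj : j < p
    · by_cases hi : i < D
      · have := congrFun (LinearMap.mem_ker.1 hαker) (⟨j, hj⟩, ⟨i, hi⟩)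
        exact this
      · by_cases hc : (Um α %ₘ MM p a H).coeff j = 0
        · rw [hc]; simp
        · apply coeff_eq_zero_of_natDegree_lt
          have := hWU j hc
          have h2 : p * ((Um α %ₘ MM p a H).coeff j).natDegree ≤ n := by
            have h3 : (0 : ℤ) ≤ ε * j := by positivity
            have : (p * ((Um α %ₘ MM p a H).coeff j).natDegree : ℤ) ≤ n := by linarith
            exact_mod_cast this
          have h4 : ((Um α %ₘ MM p a H).coeff j).natDegree ≤ n / p := by
            rw [Nat.le_div_iff_mul_le hpp.pos, mul_comm]; exact h2
          omega
    · rw [coeff_eq_zero_of_degree_lt ((mod_degree a H hp _).trans_le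
        (by exact_mod_cast not_lt.1 hj))]
      simp
  -- R-th roots
  have hroot : ∀ x : E, ∃ y : E, y ^ R = x := by
    intro x
    refine ⟨x ^ R, ?_⟩
    rw [← pow_mul, ← pow_two, ← hE, FiniteField.pow_card]
  choose rt hrt using hroot
  let β : ι → E := fun t => rt (α t)
  have hβR : ∀ t, β t ^ R = α t := fun t => hrt _
  have hβ0 : β ≠ 0 := by
    intro h
    apply hα0
    funext t
    rw [← hβR t, h]
    simp [hRpos.ne']
  set V : E[X][X] := ∑ t, C (C (β t) * X ^ eV t) * X ^ fV t with hV
  have hinj : Function.Injective fun t => p * eV t + ε * fV t := by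
    intro t s hts
    have e1 : ∀ t : ι, p * eV t + ε * fV t = (p * t.1 + ε * t.2.1)
        + R * (p * t.2.2.1 + ε * t.2.2.2) := by
      intro t; simp only [eV, fV]; ring
    simp only [e1] at hts
    have l1 : p * (t.1 : ℕ) + ε * t.2.1 < R := by have := bnd1 t.1 t.2.1; omega
    have l2 : p * (s.1 : ℕ) + ε * s.2.1 < R := by have := bnd1 s.1 s.2.1; omega
    have m1 := congrArg (· % R) hts
    have m2 := congrArg (· / R) hts
    simp only [Nat.add_mul_mod_self_left, Nat.mod_eq_of_lt l1, Nat.mod_eq_of_lt l2] at m1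
    simp only [Nat.add_mul_div_left _ _ hRpos, Nat.div_eq_of_lt l1, Nat.div_eq_of_lt l2,
      zero_add] at m2
    obtain ⟨a1, a2⟩ := wt_inj hpp hε t.2.1.2 s.2.1.2 m1
    obtain ⟨a3, a4⟩ := wt_inj hpp hε t.2.2.2.2 s.2.2.2.2 m2
    exact Prod.ext (Fin.ext a1) (Prod.ext (Fin.ext a2) (Prod.ext (Fin.ext a3) (Fin.ext a4)))
  have hVne := sum_mod_ne_zero a H hp hH ha β hβ0 eV fV hinj
  rw [← hV] at hVne
  set v := V %ₘ MM p a H with hv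
  obtain ⟨j, hj⟩ : ∃ j, v.coeff j ≠ 0 := by
    by_contra! h
    exact hVne (Polynomial.ext fun j => by rw [h j, coeff_zero])
  have hWV : WE p ε n' v := by
    have : v = ∑ t, (C (C (β t) * X ^ eV t) * X ^ fV t) %ₘ MM p a H :=
      map_sum (modByMonicHom (MM p a H)) _ _
    rw [this]
    apply WE.sum
    intro t _
    refine (WE_mod_mon a H hp hH ha _ _).mono ?_
    have hdeg : (C (β t) * X ^ eV t : E[X]).natDegree ≤ eV t := natDegree_C_mul_X_pow_le _ _
    have : p * (C (β t) * X ^ eV t : E[X]).natDegree + ε * fV t ≤ n' := by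
      calc _ ≤ p * eV t + ε * fV t := by gcongr
        _ = (p * t.1 + ε * t.2.1) + R * (p * t.2.2.1 + ε * t.2.2.2) := by
          simp only [eV, fV]; ring
        _ ≤ n' := by
          rw [hn']
          have := bnd1 t.1 t.2.1
          have := bnd2 t.2.2.1 t.2.2.2
          gcongr
    exact_mod_cast this
  have hdegv : p * (v.coeff j).natDegree ≤ n' := by
    have := hWV j hj
    have h3 : (0 : ℤ) ≤ ε * j := by positivity
    have : (p * (v.coeff j).natDegree : ℤ) ≤ n' := by linarith
    exact_mod_cast this
  -- vanishing
  have hvan : ∀ z ∈ Z, (v.coeff j).eval z = 0 := by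
    intro z hz
    obtain ⟨S, hS, hSy⟩ := hZ z hz
    have hroots : ∀ y ∈ S, (v.map (evalRingHom z)).eval y = 0 := by
      intro y hy
      rw [hv, eval_mod a H V z y (hSy y hy), hV, eval_monsum]
      have hsq : ∀ x : E, x ^ (R * R) = x := by
        intro x; rw [← pow_two, ← hE, FiniteField.pow_card]
      have h0 : (∑ t, β t * z ^ eV t * y ^ fV t) ^ R = 0 := by
        rw [hRdef, sum_pow_char_pow, ← hRdef]
        have h1 := eval_mod a H (Um α) z y (hSy y hy)
        rw [hU0, eval_monsum] at h1
        simp only [Polynomial.map_zero, eval_zero] at h1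
        rw [h1]
        refine Finset.sum_congr rfl fun t _ => ?_
        rw [mul_pow, mul_pow, hβR, ← pow_mul, ← pow_mul]
        simp only [eV, fV, eU, fU]
        rw [add_mul, add_mul, pow_add, pow_add, pow_add, pow_add]
        have s1 : z ^ ((t.2.2.1 : ℕ) * R * R) = z ^ (t.2.2.1 : ℕ) := by
          rw [mul_assoc, mul_comm, pow_mul, hsq]
        have s2 : y ^ ((t.2.2.2 : ℕ) * R * R) = y ^ (t.2.2.2 : ℕ) := by
          rw [mul_assoc, mul_comm, pow_mul, hsq]
        rw [s1, s2]
      exact pow_eq_zero_iff hRpos.ne' |>.1 h0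
    have hz0 : v.map (evalRingHom z) = 0 := by
      apply eq_zero_of_degree_lt_of_eval_finset_eq_zero S _ hroots
      rw [hS]
      exact degree_map_le.trans_lt (mod_degree a H hp _)
    have := congrArg (fun q => coeff q j) hz0
    simpa using this
  have hcardZ : Z.card ≤ (v.coeff j).natDegree := by
    apply card_le_degree_of_subset_roots
    intro z hz
    rw [Finset.mem_val] at hz
    rw [mem_roots hj]
    exact hvan z hz
  calc p * Z.card ≤ p * (v.coeff j).natDegree := by gcongr
    _ ≤ n' := hdegv
    _ ≤ _ := by
      rw [hn']
      have b1 : p * A1 + ε * k ≤ R := by omega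
      have b2 : p * A2 + ε * k ≤ R + 2 * p * ε := by
        have : p * A2 + p = R + p * ε := by rw [hR, ← mul_add, hA2]; ring
        have : ε * k ≤ p * ε := by rw [mul_comm]; gcongr; omega
        have : 2 * p * ε = p * ε + p * ε := by ring
        omega
      calc _ ≤ R + R * (R + 2 * p * ε) := by gcongr
        _ = _ := by ring

theorem stepanov [Fintype E] [Fact p.Prime] [CharP E p] (l R1 e : ℕ)
    (hR : p ^ l = p * R1) (hE : Fintype.card E = (p ^ l) ^ 2)
    (P G : E[X]) (hG : G ≠ 0) (hPG : P.natDegree = G.natDegree + e) (he : ¬ p ∣ e)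
    (hε : ε = e + p * G.natDegree)
    (hR1 : p * ε + 2 ≤ R1) (Z : Finset E)
    (hZ : ∀ z ∈ Z, G.eval z ≠ 0 ∧ ∃ y, y ^ p - y = P.eval z / G.eval z) :
    p * Z.card ≤ (p ^ l) ^ 2 + (2 * p * ε + 1) * p ^ l := by
  classical
  have hpp : p.Prime := Fact.out
  have hp : 2 ≤ p := hpp.two_le
  have he0 : 0 < e := Nat.pos_of_ne_zero (by rintro rfl; simp at he)
  have hP : P ≠ 0 := by rintro rfl; simp at hPG; omega
  obtain ⟨k, hk⟩ : ∃ k, p = k + 1 := ⟨p - 1, by omega⟩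
  have hp1 : p - 1 = k := by omega
  refine stepanov_aux l R1 hR hE (G ^ (p-1)) (P * G ^ (p-1)) ?_ ?_ ?_ hR1 Z ?_
  · rw [natDegree_mul hP (pow_ne_zero _ hG), natDegree_pow, hPG, hε, hp1, hk]; ring
  · rw [natDegree_pow, hε, hp1]
    have : 2 * e ≤ p * e := by gcongr
    have h3 : (p * (k * G.natDegree) + (e + p * G.natDegree)) = p * (p * G.natDegree) + e := by
      rw [hk]; ring
    rw [h3, mul_add]; omega
  · rw [hε]; intro h; exact he ((Nat.dvd_add_left (dvd_mul_right _ _)).1 h)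
  · intro z hz
    obtain ⟨hGz, y, hy⟩ := hZ z hz
    refine ⟨(Finset.range p).image fun c : ℕ => (y + c) * G.eval z, ?_, ?_⟩
    · rw [Finset.card_image_of_injOn, Finset.card_range]
      intro c hc d hd hcd
      have h1 := mul_right_cancel₀ hGz hcd
      have h2 : (c : E) = d := add_left_cancel h1
      exact CharP.natCast_injOn_Iio E p (by simpa using hc) (by simpa using hd) h2
    · intro w hw
      obtain ⟨c, hc, rfl⟩ := Finset.mem_image.1 hw
      have hc : (c : E) ^ p = c := by
        have := map_natCast (frobenius E p) c
        rwa [frobenius_def] at this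
      rw [mul_pow, add_pow_char, hc]
      have hy' : y ^ p = y + P.eval z / G.eval z := by rw [← hy]; ring
      rw [hy']
      simp only [eval_mul, eval_pow]
      rw [hp1, hk]
      field_simp
      ring
end step

end Part2

section Part3
open Polynomial

section cnt
variable {E : Type*} [Field E]

theorem hat_coeff (β : E) (d n : ℕ) (hn : n ≤ d) (f : E[X]) :
    (reflect d (f.comp (X + C β))).coeff n = (f.comp (X + C β)).coeff (d - n) := by
  rw [coeff_reflect, revAt_le hn]

theorem comp_X_add_C_ne (β : E) {f : E[X]} (hf : f ≠ 0) : f.comp (X + C β) ≠ 0 := by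
  intro h
  apply hf
  have := congrArg (fun u => u.comp (X - C β)) h
  simpa [comp_assoc] using this

theorem hat_ne (β : E) (d : ℕ) {f : E[X]} (hf : f ≠ 0) :
    reflect d (f.comp (X + C β)) ≠ 0 := by
  rw [Ne, reflect_eq_zero_iff]
  exact comp_X_add_C_ne β hf

theorem hat_natDegree (β : E) (d : ℕ) {f : E[X]} (hf : f ≠ 0) (hd : f.natDegree ≤ d) :
    (reflect d (f.comp (X + C β))).natDegree + f.rootMultiplicity β = d := by
  have h0 := comp_X_add_C_ne β hf
  have hnd : (f.comp (X + C β)).natDegree ≤ d := by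
    rw [natDegree_comp]; simpa using hd
  have ht : f.rootMultiplicity β = (f.comp (X + C β)).natTrailingDegree :=
    rootMultiplicity_eq_natTrailingDegree
  have hle : f.rootMultiplicity β ≤ d := by
    rw [ht]; exact natTrailingDegree_le_natDegree _ |>.trans hnd
  have : (reflect d (f.comp (X + C β))).natDegree = d - f.rootMultiplicity β := by
    apply le_antisymm
    · rw [natDegree_le_iff_coeff_eq_zero]
      intro N hN
      rcases le_or_gt N d with h | h
      · rw [hat_coeff _ _ _ h]
        apply coeff_eq_zero_of_lt_natTrailingDegree
        rw [← ht]; omega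
      · rw [coeff_reflect, revAt_eq_self_of_lt h]
        exact coeff_eq_zero_of_natDegree_lt (by omega)
    · apply le_natDegree_of_ne_zero
      rw [hat_coeff _ _ _ (by omega)]
      rw [show d - (d - f.rootMultiplicity β) = (f.comp (X + C β)).natTrailingDegree by omega]
      exact (trailingCoeff_nonzero_iff_nonzero (p := f.comp (X + C β))).2 h0
  omega

theorem hat_eval (β : E) (d : ℕ) {f : E[X]} (hd : f.natDegree ≤ d) (z : E) (hz : z ≠ 0) :
    (reflect d (f.comp (X + C β))).eval z = z ^ d * f.eval (β + z⁻¹) := by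
  have hnd : (f.comp (X + C β)).natDegree ≤ d := by
    rw [natDegree_comp]; simpa using hd
  let _ : Invertible z⁻¹ := invertibleOfNonzero (inv_ne_zero hz)
  have := eval₂_reflect_mul_pow (RingHom.id E) z⁻¹ d _ hnd
  simp only [invOf_eq_inv, inv_inv] at this
  simp only [eval₂_id, eval_comp, eval_add, eval_X, eval_C] at this
  rw [add_comm β, ← this, inv_pow]
  have := pow_ne_zero d hz
  field_simp

theorem cnt_bound {p : ℕ} [Fintype E] [Fact p.Prime] [CharP E p] (l R1 e d : ℕ)
    (hR : p ^ l = p * R1) (hE : Fintype.card E = (p ^ l) ^ 2) (h g : E[X]) (hh : h ≠ 0) (hg : g ≠ 0)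
    (hhd : h.natDegree ≤ d) (hgd : g.natDegree ≤ d) (β : E)
    (hm : g.rootMultiplicity β = h.rootMultiplicity β + e) (he : ¬ p ∣ e) (γ : E)
    (Z : Finset E) (hZ : ∀ x ∈ Z, g.eval x ≠ 0 ∧ ∃ y, y ^ p - y = h.eval x / g.eval x + γ) :
    p * Z.card ≤ (p ^ l) ^ 2 +
      ((2 * p * (d + p * d) + 1) + p * p * (p * (d + p * d) + 2)) * p ^ l := by
  classical
  set G := reflect d (g.comp (X + C β)) with hGdef
  set H := reflect d (h.comp (X + C β)) with hHdef
  have e0 : 0 < e := Nat.pos_of_ne_zero (by rintro rfl; exact he (dvd_zero _))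
  have hG := hat_natDegree β d hg hgd
  have hH := hat_natDegree β d hh hhd
  rw [← hGdef] at hG
  rw [← hHdef] at hH
  have hlt : G.natDegree < H.natDegree := by omega
  have hPd : (H + C γ * G).natDegree = H.natDegree :=
    natDegree_add_eq_left_of_natDegree_lt ((natDegree_C_mul_le _ _).trans_lt hlt)
  have hgβ : g.eval β = 0 := by
    have : 0 < g.rootMultiplicity β := by omega
    exact ((rootMultiplicity_pos hg).1 this)
  have hinj : Function.Injective (fun x : E => (x - β)⁻¹) := by
    intro x y hxy
    simpa using hxy
  set ε := e + p * G.natDegree with hε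
  have hεD : ε ≤ d + p * d := by
    have h1 : e ≤ d := by omega
    have h2 : G.natDegree ≤ d := by omega
    have := Nat.mul_le_mul_left p h2
    omega
  by_cases hR1 : p * ε + 2 ≤ R1
  · have key := stepanov (E := E) (p := p) (ε := ε) l R1 e hR hE (H + C γ * G) G (hat_ne β d hg)
      (by omega) he hε hR1 (Z.image (fun x : E => (x - β)⁻¹)) ?_
    · rw [Finset.card_image_of_injective _ hinj] at key
      refine key.trans ?_
      have : 2 * p * ε + 1 ≤ (2 * p * (d + p * d) + 1) + p * p * (p * (d + p * d) + 2) := by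
        have := Nat.mul_le_mul_left (2 * p) hεD
        omega
      have := Nat.mul_le_mul_right (p ^ l) this
      omega
    · intro z hz
      obtain ⟨x, hx, rfl⟩ := Finset.mem_image.1 hz
      obtain ⟨hx1, y, hy⟩ := hZ x hx
      have hxβ : x - β ≠ 0 := by
        intro h0
        rw [sub_eq_zero] at h0
        exact hx1 (h0 ▸ hgβ)
      have hz0 : (x - β)⁻¹ ≠ 0 := inv_ne_zero hxβ
      have eG : G.eval (x - β)⁻¹ = (x - β)⁻¹ ^ d * g.eval x := by
        rw [hGdef, hat_eval β d hgd _ hz0]; simp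
      have eH : H.eval (x - β)⁻¹ = (x - β)⁻¹ ^ d * h.eval x := by
        rw [hHdef, hat_eval β d hhd _ hz0]; simp
      have hzd := pow_ne_zero d hz0
      refine ⟨by rw [eG]; exact mul_ne_zero hzd hx1, y, ?_⟩
      simp only [eval_add, eval_mul, eval_C]
      rw [hy, eG, eH]
      generalize (x - β)⁻¹ ^ d = w at *
      field_simp
  · push Not at hR1
    have h1 : Z.card ≤ (p ^ l) ^ 2 := by
      rw [← hE]; exact Finset.card_le_univ Z
    have h2 : R1 ≤ p * (d + p * d) + 2 := by
      have := Nat.mul_le_mul_left p hεD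
      omega
    calc p * Z.card ≤ p * (p ^ l) ^ 2 := Nat.mul_le_mul_left _ h1
      _ = (p * p * R1) * p ^ l := by rw [sq, ← mul_assoc]; nth_rewrite 1 [hR]; ring
      _ ≤ (p * p * (p * (d + p * d) + 2)) * p ^ l :=
        Nat.mul_le_mul_right _ (Nat.mul_le_mul_left _ h2)
      _ ≤ _ := by rw [add_mul (2 * p * (d + p * d) + 1)]; omega
end cnt

/-- additive Hilbert 90 over the prime field -/
theorem artin_schreier_exists {E : Type*} [Field E] [Fintype E] {p : ℕ} [Fact p.Prime] [CharP E p]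
    [Algebra (ZMod p) E] (u : E) (hu : Algebra.trace (ZMod p) E u = 0) : ∃ y : E, y ^ p - y = u := by
  classical
  let φ : E →ₗ[ZMod p] E :=
    { toFun := fun y => y ^ p - y
      map_add' := fun x y => by simp only [add_pow_char]; ring
      map_smul' := fun c x => by
        simp only [RingHom.id_apply, _root_.smul_pow, ZMod.pow_card, smul_sub] }
  have hle : LinearMap.range φ ≤ LinearMap.ker (Algebra.trace (ZMod p) E) := by
    rintro _ ⟨y, rfl⟩
    rw [LinearMap.mem_ker]
    change Algebra.trace (ZMod p) E (y ^ p - y) = 0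
    have := Algebra.trace_eq_of_algEquiv (FiniteField.frobeniusAlgEquiv (ZMod p) E p) y
    rw [map_sub, sub_eq_zero]
    simpa [FiniteField.frobeniusAlgEquiv] using this
  have hker : Module.finrank (ZMod p) (LinearMap.ker φ) ≤ 1 := by
    have : LinearMap.ker φ ≤ LinearMap.range (Algebra.linearMap (ZMod p) E) := by
      intro y hy
      have hy : y ^ p - y = 0 := hy
      have h1 := (Subfield.mem_bot_iff_pow_eq_self E p).2 (sub_eq_zero.1 hy)
      obtain ⟨n, hn⟩ := (mem_bot_iff_intCast p E).1 h1
      exact ⟨(n : ZMod p), by simpa using hn⟩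
    refine (Submodule.finrank_mono this).trans ?_
    refine (LinearMap.finrank_range_le _).trans ?_
    simp
  have h1 := LinearMap.finrank_range_add_finrank_ker φ
  have h2 := LinearMap.finrank_range_add_finrank_ker (Algebra.trace (ZMod p) E)
  have h3 : Module.finrank (ZMod p) (LinearMap.range (Algebra.trace (ZMod p) E)) = 1 := by
    rw [LinearMap.range_eq_top.2 (Algebra.trace_surjective (ZMod p) E)]
    simp
  have heq := Submodule.eq_of_le_of_finrank_le hle (by omega)
  have : u ∈ LinearMap.range φ := by rw [heq]; exact hu
  exact this

/-- the constant of the weak bound -/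
def wkC (p d : ℕ) : ℕ := ((2 * p * (d + p * d) + 1) + p * p * (p * (d + p * d) + 2)) + d

/-- weak exponential sum bound -/
theorem weak_bound {E : Type*} [Field E] {p : ℕ} [Fintype E] [DecidableEq E] [Fact p.Prime]
    [Algebra (ZMod p) E] (l R1 e d : ℕ)
    (hR : p ^ l = p * R1) (hE : Fintype.card E = (p ^ l) ^ 2) (h g : E[X]) (hh : h ≠ 0) (hg : g ≠ 0)
    (hhd : h.natDegree ≤ d) (hgd : g.natDegree ≤ d) (β : E)
    (hm : g.rootMultiplicity β = h.rootMultiplicity β + e) (he : ¬ p ∣ e) :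
    ‖∑ x : E, (if g.eval x = 0 then (0 : ℂ) else
      ZMod.stdAddChar (Algebra.trace (ZMod p) E (h.eval x / g.eval x)))‖ ≤ wkC p d * (p : ℝ) ^ l := by
  classical
  haveI : CharP E p := charP_of_injective_algebraMap (algebraMap (ZMod p) E).injective p
  set C0 := (2 * p * (d + p * d) + 1) + p * p * (p * (d + p * d) + 2) with hC0
  set A : Finset E := Finset.univ.filter (fun x => g.eval x ≠ 0) with hA
  set t : E → ZMod p := fun x => Algebra.trace (ZMod p) E (h.eval x / g.eval x) with ht
  set N : ZMod p → ℕ := fun c => (A.filter (fun x => t x = c)).card with hN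
  have hsum : ∑ x : E, (if g.eval x = 0 then (0 : ℂ) else ZMod.stdAddChar (t x)) =
      ∑ c : ZMod p, (N c : ℂ) * ZMod.stdAddChar c := by
    have : ∑ x : E, (if g.eval x = 0 then (0 : ℂ) else ZMod.stdAddChar (t x)) =
        ∑ x ∈ A, ZMod.stdAddChar (t x) := by
      rw [hA, Finset.sum_filter]
      refine Finset.sum_congr rfl fun x _ => ?_
      by_cases hx : g.eval x = 0 <;> simp [hx]
    rw [this, ← Finset.sum_fiberwise A t]
    refine Finset.sum_congr rfl fun c _ => ?_
    rw [Finset.sum_congr rfl (g := fun _ => ZMod.stdAddChar c), Finset.sum_const, nsmul_eq_mul]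
    intro x hx
    rw [(Finset.mem_filter.1 hx).2]
  have hNc : ∀ c, p * N c ≤ (p ^ l) ^ 2 + C0 * p ^ l := by
    intro c
    obtain ⟨γ, hγ⟩ := Algebra.trace_surjective (ZMod p) E (-c)
    refine cnt_bound l R1 e d hR hE h g hh hg hhd hgd β hm he γ _ ?_
    intro x hx
    rw [Finset.mem_filter, hA, Finset.mem_filter] at hx
    refine ⟨hx.1.2, artin_schreier_exists _ ?_⟩
    rw [map_add, hγ]
    have := hx.2
    simp only [ht] at this
    rw [this]; ring
  have hNs : ∑ c, N c + d ≥ (p ^ l) ^ 2 := by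
    have h1 : ∑ c, N c = A.card := by
      have := Finset.card_eq_sum_card_fiberwise (f := t) (s := A) (t := Finset.univ) (by simp)
      exact this.symm
    have h2 : (Finset.univ.filter (fun x => ¬ g.eval x ≠ 0)).card ≤ d := by
      refine le_trans ?_ ((card_roots' g).trans hgd)
      refine le_trans (Finset.card_le_card ?_) (Multiset.toFinset_card_le g.roots)
      intro x hx
      simpa [hg] using hx
    have h3 := Finset.card_filter_add_card_filter_not (s := (Finset.univ : Finset E)) (fun x => g.eval x ≠ 0)
    rw [Finset.card_univ, hE] at h3
    have h4 : A.card = (Finset.univ.filter (fun x => g.eval x ≠ 0)).card := by rw [hA]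
    rw [h1, h4]
    omega
  have hp0 : 0 < p := (Fact.out : p.Prime).pos
  have hpR : (0 : ℝ) < p := by exact_mod_cast hp0
  set T : ℝ := (((p : ℝ) ^ l) ^ 2 + C0 * (p : ℝ) ^ l) / p with hT
  have hz : ∑ c : ZMod p, (ZMod.stdAddChar c : ℂ) = 0 := by
    have h1 := ZMod.isPrimitive_stdAddChar p (one_ne_zero)
    rw [AddChar.mulShift_one] at h1
    exact AddChar.sum_eq_zero_of_ne_one h1
  have hTN : ∀ c, (N c : ℝ) ≤ T := by
    intro c
    rw [hT, le_div_iff₀ hpR, mul_comm]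
    exact_mod_cast hNc c
  have h2 : ∑ c : ZMod p, (N c : ℂ) * ZMod.stdAddChar c =
      ∑ c : ZMod p, (((N c : ℝ) - T : ℝ) : ℂ) * ZMod.stdAddChar c := by
    simp only [Complex.ofReal_sub, sub_mul, Finset.sum_sub_distrib, ← Finset.mul_sum, hz]
    simp
  change ‖∑ x : E, (if g.eval x = 0 then (0 : ℂ) else ZMod.stdAddChar (t x))‖ ≤ _
  rw [hsum, h2]
  have hR1 : (1 : ℝ) ≤ (p : ℝ) ^ l := by exact_mod_cast Nat.one_le_pow _ _ hp0
  calc ‖∑ c : ZMod p, (((N c : ℝ) - T : ℝ) : ℂ) * ZMod.stdAddChar c‖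
      ≤ ∑ c : ZMod p, ‖(((N c : ℝ) - T : ℝ) : ℂ) * ZMod.stdAddChar c‖ := norm_sum_le _ _
    _ = ∑ c : ZMod p, (T - N c) := by
      refine Finset.sum_congr rfl fun c _ => ?_
      rw [norm_mul, Complex.norm_real, ZMod.stdAddChar_apply, Circle.norm_coe, mul_one,
        Real.norm_eq_abs, abs_of_nonpos (by linarith [hTN c])]
      ring
    _ = p * T - ∑ c, (N c : ℝ) := by
      rw [Finset.sum_sub_distrib, Finset.sum_const, Finset.card_univ, ZMod.card, nsmul_eq_mul]
    _ = ((p : ℝ) ^ l) ^ 2 + C0 * (p : ℝ) ^ l - ∑ c, (N c : ℝ) := by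
      rw [hT]; field_simp
    _ ≤ C0 * (p : ℝ) ^ l + d := by
      have : ((p : ℝ) ^ l) ^ 2 ≤ ∑ c, (N c : ℝ) + d := by exact_mod_cast hNs
      linarith
    _ ≤ wkC p d * (p : ℝ) ^ l := by
      rw [wkC, ← hC0]
      push_cast
      have : (d : ℝ) ≤ d * (p : ℝ) ^ l := le_mul_of_one_le_right (Nat.cast_nonneg _) hR1
      linarith

end Part3

section Part4
open Polynomial

section lam
variable {K : Type*} [Field K]

/-- a chosen inverse of `a` modulo `g` -/
noncomputable def linv (g a : K[X]) : K[X] := by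
  classical
  exact if h : ∃ i : K[X], g ∣ a * i - 1 then h.choose else 0

theorem exists_linv {g a : K[X]} (h : IsCoprime a g) : ∃ i : K[X], g ∣ a * i - 1 := by
  obtain ⟨u, v, huv⟩ := h
  exact ⟨u, -v, by linear_combination huv⟩

theorem linv_spec {g a : K[X]} (h : IsCoprime a g) : g ∣ a * linv g a - 1 := by
  have h1 := exists_linv h
  unfold linv
  rw [dif_pos h1]
  exact h1.choose_spec

/-- coefficient functional -/
noncomputable def lamI (g h a i : K[X]) : K := -((h * derivative a * i) %ₘ g).coeff (g.natDegree - 1)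

/-- the logarithmic-derivative residue functional -/
noncomputable def lam (g h a : K[X]) : K := lamI g h a (linv g a)

theorem lamI_congr {g h a b i j : K[X]} (hg : g.Monic) (hab : g ∣ derivative a - derivative b)
    (hab' : g ∣ a - b) (hi : g ∣ a * i - 1) (hj : g ∣ b * j - 1) : lamI g h a i = lamI g h b j := by
  unfold lamI
  rw [modByMonic_eq_of_dvd_sub hg]
  obtain ⟨u, hu⟩ := hab
  obtain ⟨v, hv⟩ := hab'
  obtain ⟨w, hw⟩ := hi
  obtain ⟨z, hz⟩ := hj
  refine ⟨h * u * i + h * derivative b * (j * w - i * z - i * j * v), ?_⟩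
  linear_combination h * i * hu + h * derivative b * (j * hw - i * hz - i * j * hv)

theorem lam_eq {g h a i : K[X]} (hg : g.Monic) (hi : g ∣ a * i - 1) : lam g h a = lamI g h a i := by
  have hc : IsCoprime a g := by
    obtain ⟨v, hv⟩ := hi
    exact ⟨i, -v, by linear_combination hv⟩
  exact lamI_congr hg (by simp) (by simp) (linv_spec hc) hi

theorem lam_mul {g h a b : K[X]} (hg : g.Monic) (ha : IsCoprime a g) (hb : IsCoprime b g) :
    lam g h (a * b) = lam g h a + lam g h b := by
  obtain ⟨w, hw⟩ := linv_spec ha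
  obtain ⟨z, hz⟩ := linv_spec hb
  set i := linv g a with hi
  set j := linv g b with hj
  rw [lam_eq (i := i * j) hg ⟨w * (b * j) + z, by linear_combination (b * j) * hw + hz⟩]
  unfold lam lamI
  rw [← hi, ← hj, ← neg_add, ← coeff_add, ← add_modByMonic]
  congr 2
  apply modByMonic_eq_of_dvd_sub hg
  refine ⟨h * derivative a * i * z + h * derivative b * j * w, ?_⟩
  rw [derivative_mul]
  linear_combination h * derivative a * i * hz + h * derivative b * j * hw

theorem lam_one {g h : K[X]} (hg : g.Monic) : lam g h 1 = 0 := by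
  rw [lam_eq (i := 1) hg (by simp)]
  simp [lamI]

theorem lam_pow {g h a : K[X]} (hg : g.Monic) (ha : IsCoprime a g) (n : ℕ) :
    lam g h (a ^ n) = n * lam g h a := by
  induction n with
  | zero => simp [lam_one hg]
  | succ n ih => rw [pow_succ, lam_mul hg ha.pow_left ha, ih]; push_cast; ring

theorem lam_prod {ι : Type*} {g h : K[X]} (hg : g.Monic) (s : Finset ι) (f : ι → K[X])
    (hf : ∀ i ∈ s, IsCoprime (f i) g) : lam g h (∏ i ∈ s, f i) = ∑ i ∈ s, lam g h (f i) := by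
  classical
  induction s using Finset.induction_on with
  | empty => simp [lam_one hg]
  | insert a s ha ih =>
    rw [Finset.prod_insert ha, Finset.sum_insert ha, lam_mul hg, ih]
    · exact fun i hi => hf i (Finset.mem_insert_of_mem hi)
    · exact hf a (Finset.mem_insert_self _ _)
    · exact IsCoprime.prod_left fun i hi => hf i (Finset.mem_insert_of_mem hi)

theorem lam_map {E : Type*} [Field E] (φ : K →+* E) {g h a : K[X]} (hg : g.Monic)
    (ha : IsCoprime a g) : lam (g.map φ) (h.map φ) (a.map φ) = φ (lam g h a) := by
  rw [lam_eq (i := (linv g a).map φ) (hg.map φ)]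
  · unfold lam lamI
    rw [map_neg, ← coeff_map, map_modByMonic _ hg, hg.natDegree_map]
    simp [derivative_map]
  · have := Polynomial.map_dvd φ (linv_spec ha)
    simpa using this

theorem lam_periodic {g h a b N : K[X]} (hg : g.Monic) (hN : g ∣ N) (hN' : g ∣ derivative N)
    (hab : N ∣ a - b) (ha : IsCoprime a g) (hb : IsCoprime b g) : lam g h a = lam g h b := by
  refine lamI_congr hg ?_ (hN.trans hab) (linv_spec ha) (linv_spec hb)
  obtain ⟨t, ht⟩ := hab
  rw [← derivative_sub, ht, derivative_mul]
  exact dvd_add (hN'.mul_right _) (hN.mul_right _)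

theorem lam_linear {g h : K[X]} (hg : g.Monic) (hd : h.degree < g.degree) (α : K)
    (hα : g.eval α ≠ 0) : lam g h (X - C α) = h.eval α / g.eval α := by
  set k := g /ₘ (X - C α) with hk
  set t := h /ₘ (X - C α) with ht
  have hmon : (X - C α).Monic := monic_X_sub_C α
  have eg : C (g.eval α) + (X - C α) * k = g := by
    have := modByMonic_add_div g (X - C α)
    rwa [modByMonic_X_sub_C_eq_C_eval] at this
  have eh : C (h.eval α) + (X - C α) * t = h := by
    have := modByMonic_add_div h (X - C α)
    rwa [modByMonic_X_sub_C_eq_C_eval] at this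
  have hCC : C (g.eval α)⁻¹ * C (g.eval α) = 1 := by
    rw [← C_mul, inv_mul_cancel₀ hα, C_1]
  rw [lam_eq (i := -(C (g.eval α)⁻¹ * k)) hg
    ⟨-C (g.eval α)⁻¹, by linear_combination (-C (g.eval α)⁻¹) * eg + hCC⟩]
  by_cases hd1 : g.natDegree = 0
  · have h1 : g = 1 := hg.natDegree_eq_zero.1 hd1
    have h0 : h = 0 := by
      rw [h1, degree_one] at hd
      exact degree_eq_bot.1 (by
        by_contra hne
        have := (zero_le_degree_iff (p := h)).2 (by rintro rfl; simp at hne)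
        exact absurd hd (not_lt.2 this))
    simp [lamI, h0]
  have hdn : h.natDegree < g.natDegree := by
    by_cases h0 : h = 0
    · simp [h0]; omega
    · exact natDegree_lt_natDegree h0 hd
  have htdeg : t.natDegree = h.natDegree - 1 := by
    rw [ht, natDegree_divByMonic _ hmon, natDegree_X_sub_C]
  have hkdeg : k.natDegree = g.natDegree - 1 := by
    rw [hk, natDegree_divByMonic _ hmon, natDegree_X_sub_C]
  have hkm : k.coeff (g.natDegree - 1) = 1 := by
    have h1 : k.leadingCoeff = g.leadingCoeff := by
      rw [hk]
      apply leadingCoeff_divByMonic_of_monic hmon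
      rw [degree_X_sub_C]
      exact Nat.WithBot.one_le_iff_zero_lt.2 (natDegree_pos_iff_degree_pos.1 (by omega))
    rw [← hkdeg]
    exact h1.trans hg
  have ht0 : t.coeff (g.natDegree - 1) = 0 := by
    by_cases hh0 : h.natDegree = 0
    · have : t = 0 := by
        rw [ht]
        apply (divByMonic_eq_zero_iff hmon).2
        rw [degree_X_sub_C]
        exact (degree_le_of_natDegree_le hh0.le).trans_lt (by simp)
      simp [this]
    · exact coeff_eq_zero_of_natDegree_lt (by omega)
  have hrem : (h * derivative (X - C α) * -(C (g.eval α)⁻¹ * k)) %ₘ g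
      = -C (h.eval α / g.eval α) * k + t := by
    have hdeg : (-C (h.eval α / g.eval α) * k + t).degree < g.degree := by
      refine (degree_add_le _ _).trans_lt (max_lt ?_ ?_)
      · rw [← C_neg]
        exact degree_lt_degree ((natDegree_C_mul_le _ _).trans_lt (by omega))
      · exact degree_lt_degree (by omega)
    rw [← (modByMonic_eq_self_iff hg).2 hdeg]
    apply modByMonic_eq_of_dvd_sub hg
    have e2 : C (h.eval α / g.eval α) = C (h.eval α) * C (g.eval α)⁻¹ := by
      rw [← C_mul, div_eq_mul_inv]
    refine ⟨-t * C (g.eval α)⁻¹, ?_⟩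
    rw [e2]
    simp only [derivative_sub, derivative_X, derivative_C, sub_zero, mul_one]
    linear_combination (C (g.eval α)⁻¹ * k) * eh - t * C (g.eval α)⁻¹ * eg + t * hCC
  unfold lamI
  rw [hrem]
  simp [hkm, ht0, ← C_neg, -map_neg]

theorem exists_radical (g : K[X]) (hg : g ≠ 0) : ∃ ρ : K[X], ρ.Monic ∧ Squarefree ρ ∧ ρ ∣ g ∧
    g ∣ derivative (g * ρ) := by
  classical
  set w := UniqueFactorizationMonoid.radical g with hw
  have hw0 : w ≠ 0 := UniqueFactorizationMonoid.radical_ne_zero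
  have hu : IsUnit (C (w.leadingCoeff)⁻¹) := isUnit_C.2 (IsUnit.mk0 _ (by simpa using hw0))
  have hass : Associated w (w * C (w.leadingCoeff)⁻¹) := associated_mul_unit_right _ _ hu
  refine ⟨w * C (w.leadingCoeff)⁻¹, monic_mul_leadingCoeff_inv hw0, ?_, ?_, ?_⟩
  · exact hass.squarefree_iff.1 UniqueFactorizationMonoid.squarefree_radical
  · exact hass.dvd_iff_dvd_left.1 UniqueFactorizationMonoid.radical_dvd_self
  · rw [derivative_mul]
    refine dvd_add ?_ (dvd_mul_right _ _)
    rw [← mul_assoc]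
    refine Dvd.dvd.mul_right ?_ _
    have h1 := divRadical_dvd_derivative g
    have h2 : w * EuclideanDomain.divRadical g = g :=
      EuclideanDomain.radical_mul_divRadical
    obtain ⟨c, hc⟩ := h1
    refine ⟨c, ?_⟩
    rw [hc]
    conv_rhs => rw [← h2]
    ring
end lam

end Part4

section Part5
open Polynomial

section analytic

theorem multiset_eval_sum (s : Multiset ℂ) (Q : ℂ[X]) (k : ℕ) :
    (s.map (fun w => w ^ k * Q.eval w)).sum =
      ∑ j ∈ Finset.range (Q.natDegree + 1), Q.coeff j * (s.map (fun w => w ^ (k + j))).sum := by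
  simp only [← Multiset.sum_map_mul_left]
  rw [Finset.sum_eq_multiset_sum, Multiset.sum_map_sum_map]
  congr 1
  refine Multiset.map_congr rfl fun w _ => ?_
  rw [eval_eq_sum_range, Finset.mul_sum, Finset.sum_eq_multiset_sum]
  congr 1
  refine Multiset.map_congr rfl fun j _ => ?_
  ring

theorem roots_bound (s : Multiset ℂ) (A B : ℝ) (hB : 0 < B)
    (h : ∀ k : ℕ, 1 ≤ k → ‖(s.map (fun w => w ^ k)).sum‖ ≤ A * B ^ k) : ∀ w ∈ s, ‖w‖ ≤ B := by
  classical
  intro v hv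
  by_contra hlt
  push Not at hlt
  set Q : ℂ[X] := ∏ μ ∈ s.toFinset.erase v, (X - C μ) with hQ
  have hQv : Q.eval v ≠ 0 := by
    rw [hQ, eval_prod]
    refine Finset.prod_ne_zero_iff.2 fun μ hμ => ?_
    simp only [eval_sub, eval_X, eval_C]
    exact sub_ne_zero.2 (Finset.ne_of_mem_erase hμ).symm
  have hQw : ∀ w ∈ s, w ≠ v → Q.eval w = 0 := by
    intro w hw hne
    rw [hQ, eval_prod]
    exact Finset.prod_eq_zero (Finset.mem_erase.2 ⟨hne, Multiset.mem_toFinset.2 hw⟩) (by simp)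
  have h1 : ∀ k, (s.map (fun w => w ^ k * Q.eval w)).sum = s.count v * (v ^ k * Q.eval v) := by
    intro k
    rw [Finset.sum_multiset_map_count, Finset.sum_eq_single v]
    · simp
    · intro w hw hne
      rw [hQw w (Multiset.mem_toFinset.1 hw) hne]; simp
    · intro hn; exact absurd (Multiset.mem_toFinset.2 hv) hn
  set A' := ∑ j ∈ Finset.range (Q.natDegree + 1), ‖Q.coeff j‖ * (A * B ^ j) with hA'
  have h2 : ∀ k, 1 ≤ k → ‖v‖ ^ k * ‖Q.eval v‖ ≤ A' * B ^ k := by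
    intro k hk
    have h3 : ‖(s.map (fun w => w ^ k * Q.eval w)).sum‖ ≤ A' * B ^ k := by
      rw [multiset_eval_sum, hA', Finset.sum_mul]
      refine (norm_sum_le _ _).trans (Finset.sum_le_sum fun j _ => ?_)
      rw [norm_mul]
      calc _ ≤ ‖Q.coeff j‖ * (A * B ^ (k + j)) :=
            mul_le_mul_of_nonneg_left (h _ (by omega)) (norm_nonneg _)
        _ = _ := by ring
    rw [h1, norm_mul, norm_mul, norm_pow, Complex.norm_natCast] at h3
    refine le_trans ?_ h3
    apply le_mul_of_one_le_left (by positivity)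
    exact_mod_cast Multiset.count_pos.2 hv
  have hx : 1 < ‖v‖ / B := (one_lt_div hB).2 hlt
  have hq : 0 < ‖Q.eval v‖ := norm_pos_iff.2 hQv
  obtain ⟨n, hn⟩ := pow_unbounded_of_one_lt (A' / ‖Q.eval v‖) hx
  have hn1 : A' / ‖Q.eval v‖ < (‖v‖ / B) ^ (n + 1) :=
    hn.trans_le (pow_le_pow_right₀ hx.le (by omega))
  have h4 := h2 (n + 1) (by omega)
  rw [div_lt_iff₀ hq, div_pow, div_mul_eq_mul_div, lt_div_iff₀ (by positivity)] at hn1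
  linarith

theorem roots_bound' (s : Multiset ℂ) (k0 : ℕ) (hk0 : 1 ≤ k0) (A B : ℝ) (hB : 0 < B)
    (h : ∀ k : ℕ, 1 ≤ k → k0 ∣ k → ‖(s.map (fun w => w ^ k)).sum‖ ≤ A * B ^ k) :
    ∀ w ∈ s, ‖w‖ ≤ B := by
  intro w hw
  have := roots_bound (s.map (fun w => w ^ k0)) A (B ^ k0) (by positivity) ?_ (w ^ k0)
    (Multiset.mem_map_of_mem _ hw)
  · rw [norm_pow] at this
    exact le_of_pow_le_pow_left₀ (by omega) hB.le this
  · intro k hk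
    rw [Multiset.map_map]
    have := h (k0 * k) (Nat.mul_pos hk0 hk) (dvd_mul_right _ _)
    simpa [pow_mul] using this

/-- Newton's identities in generating function form -/
theorem newton_ps (s : Multiset ℂ) (n : ℕ) :
    (n : ℂ) * ((s.map (fun w => (1 - C w * X : ℂ[X]))).prod).coeff n =
      - ∑ k ∈ Finset.Icc 1 n, (s.map (fun w => w ^ k)).sum *
        ((s.map (fun w => (1 - C w * X : ℂ[X]))).prod).coeff (n - k) := by
  induction s using Multiset.induction_on generalizing n with
  | empty =>
    rcases n with _ | n <;> simp [coeff_one]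
  | cons w s ih =>
    simp only [Multiset.map_cons, Multiset.prod_cons, Multiset.sum_cons]
    set L := (s.map (fun w => (1 - C w * X : ℂ[X]))).prod with hL
    set P : ℕ → ℂ := fun k => (s.map (fun w => w ^ k)).sum with hP
    have hc : ∀ j, ((1 - C w * X) * L).coeff (j + 1) = L.coeff (j + 1) - w * L.coeff j := by
      intro j
      rw [sub_mul, one_mul, mul_assoc, coeff_sub, coeff_C_mul, coeff_X_mul]
    have hc0 : ((1 - C w * X) * L).coeff 0 = L.coeff 0 := by
      simp [mul_coeff_zero]
    rcases n with _ | n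
    · simp
    have ih1 := ih (n + 1)
    have ih0 := ih n
    -- split the sums
    have hA : ∀ k ∈ Finset.Icc 1 n, ((1 - C w * X) * L).coeff (n + 1 - k) =
        L.coeff (n + 1 - k) - w * L.coeff (n - k) := by
      intro k hk
      rw [Finset.mem_Icc] at hk
      rw [show n + 1 - k = (n - k) + 1 by omega, hc]
    have tel : ∀ n : ℕ, ∑ k ∈ Finset.Icc 1 n, w ^ k * ((1 - C w * X) * L).coeff (n - k) =
        w * ∑ k ∈ Finset.range n, w ^ k * ((1 - C w * X) * L).coeff (n - 1 - k) := by
      intro n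
      rw [Finset.mul_sum]
      refine (Finset.sum_nbij' (fun k => k + 1) (fun k => k - 1) ?_ ?_ ?_ ?_ ?_).symm
      · intro k hk
        simp only [Finset.mem_range, Finset.mem_Icc] at hk ⊢
        omega
      · intro k hk
        simp only [Finset.mem_range, Finset.mem_Icc] at hk ⊢
        omega
      · intro k hk
        simp
      · intro k hk
        simp only [Finset.mem_Icc] at hk
        omega
      · intro k hk
        rw [pow_succ, show n - (k + 1) = n - 1 - k by omega]; ring
    have tel2 : ∀ n : ℕ, ∑ k ∈ Finset.range (n + 1), w ^ k * ((1 - C w * X) * L).coeff (n - k) =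
        L.coeff n := by
      intro n
      induction n with
      | zero => simp [hc0]
      | succ n ihn =>
        rw [Finset.sum_range_succ']
        simp only [pow_zero, one_mul, Nat.sub_zero, hc, Nat.add_sub_add_right]
        have : ∑ k ∈ Finset.range (n + 1), w ^ (k + 1) * ((1 - C w * X) * L).coeff (n - k) =
            w * L.coeff n := by
          rw [← ihn, Finset.mul_sum]
          exact Finset.sum_congr rfl fun k _ => by ring
        rw [this]; ring
    have e1 : ∑ k ∈ Finset.Icc 1 (n + 1), w ^ k * ((1 - C w * X) * L).coeff (n + 1 - k) =
        w * L.coeff n := by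
      rw [tel]
      simp only [Nat.add_sub_cancel]
      rw [tel2]
    simp only [add_mul, Finset.sum_add_distrib]
    rw [e1, hc, Finset.sum_Icc_succ_top (by omega), Nat.sub_self, hc0]
    rw [Finset.sum_congr rfl fun k hk => by rw [hA k hk]]
    rw [Finset.sum_Icc_succ_top (by omega), Nat.sub_self] at ih1
    simp only [mul_sub, Finset.sum_sub_distrib]
    have e3 : ∑ k ∈ Finset.Icc 1 n, P k * (w * L.coeff (n - k)) =
        w * ∑ k ∈ Finset.Icc 1 n, P k * L.coeff (n - k) := by
      rw [Finset.mul_sum]; exact Finset.sum_congr rfl fun k _ => by ring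
    rw [e3]
    push_cast at ih1 ⊢
    linear_combination ih1 - w * ih0

theorem exists_multiset (L : ℂ[X]) (h0 : L.coeff 0 = 1) : ∃ s : Multiset ℂ,
    s.card ≤ L.natDegree ∧ L = (s.map (fun w => (1 - C w * X : ℂ[X]))).prod := by
  have hsp : L.Splits := IsAlgClosed.splits L
  have hL0 : L ≠ 0 := by rintro rfl; simp at h0
  refine ⟨L.roots.map (fun z => z⁻¹), by simpa using card_roots' L, ?_⟩
  have h1 := hsp.eq_prod_roots
  have hz : ∀ z ∈ L.roots, z ≠ 0 := by
    rintro z hz rfl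
    rw [mem_roots hL0, IsRoot.def, ← coeff_zero_eq_eval_zero, h0] at hz
    exact one_ne_zero hz
  have h2 : (L.roots.map (fun z => (X - C z : ℂ[X]))).prod =
      C (L.roots.map (fun z => -z)).prod * ((L.roots.map (fun z => z⁻¹)).map
        (fun w => (1 - C w * X : ℂ[X]))).prod := by
    rw [map_multiset_prod, Multiset.map_map, Multiset.map_map, ← Multiset.prod_map_mul]
    congr 1
    refine Multiset.map_congr rfl fun z hz' => ?_
    have : C z * C z⁻¹ = (1 : ℂ[X]) := by rw [← C_mul, mul_inv_cancel₀ (hz z hz'), C_1]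
    simp only [Function.comp, C_neg]
    linear_combination (-X) * this
  set T := ((L.roots.map (fun z => z⁻¹)).map (fun w => (1 - C w * X : ℂ[X]))).prod with hT
  have hT0 : T.eval 0 = 1 := by
    rw [hT, eval_multiset_prod, Multiset.map_map]
    apply Multiset.prod_eq_one
    intro x hx
    obtain ⟨w, _, rfl⟩ := Multiset.mem_map.1 hx
    simp
  rw [h2, ← mul_assoc, ← C_mul] at h1
  have h3 := congrArg (eval 0) h1
  rw [eval_mul, hT0, eval_C, mul_one, ← coeff_zero_eq_eval_zero, h0] at h3
  rw [← h3, C_1, one_mul] at h1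
  exact h1

theorem newton_bound (c S : ℕ → ℂ) (D : ℕ) (hD : 1 ≤ D) (hc0 : c 0 = 1) (hcD : ∀ n, D ≤ n → c n = 0)
    (hrec : ∀ n : ℕ, (n : ℂ) * c n = ∑ k ∈ Finset.Icc 1 n, S k * c (n - k))
    (k0 : ℕ) (hk0 : 1 ≤ k0) (A B : ℝ) (hB : 0 < B)
    (hS : ∀ k, 1 ≤ k → k0 ∣ k → ‖S k‖ ≤ A * B ^ k) : ‖S 1‖ ≤ ((D : ℝ) - 1) * B := by
  set L : ℂ[X] := ∑ n ∈ Finset.range D, monomial n (c n) with hL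
  have hcoeff : ∀ n, L.coeff n = c n := by
    intro n
    rw [hL, finsetSum_coeff]
    simp only [coeff_monomial]
    rw [Finset.sum_ite_eq']
    split_ifs with h
    · rfl
    · rw [hcD n (by simpa using h)]
  have hdeg : L.natDegree ≤ D - 1 := by
    rw [natDegree_le_iff_coeff_eq_zero]
    intro n hn
    rw [hcoeff, hcD n (by omega)]
  obtain ⟨s, hs, hLs⟩ := exists_multiset L (by rw [hcoeff, hc0])
  have hSk : ∀ k, 1 ≤ k → S k = - (s.map (fun w => w ^ k)).sum := by
    intro k
    induction k using Nat.strong_induction_on with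
    | _ n ih =>
      intro hn
      have h1 := newton_ps s n
      rw [← hLs] at h1
      simp only [hcoeff] at h1
      rw [hrec n] at h1
      obtain ⟨n, rfl⟩ : ∃ t, n = t + 1 := ⟨n - 1, by omega⟩
      rw [Finset.sum_Icc_succ_top (by omega), Finset.sum_Icc_succ_top (by omega), Nat.sub_self,
        hc0] at h1
      have h2 : ∑ k ∈ Finset.Icc 1 n, S k * c (n + 1 - k) =
          - ∑ k ∈ Finset.Icc 1 n, (s.map (fun w => w ^ k)).sum * c (n + 1 - k) := by
        rw [← Finset.sum_neg_distrib]
        refine Finset.sum_congr rfl fun k hk => ?_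
        rw [Finset.mem_Icc] at hk
        rw [ih k (by omega) hk.1]; ring
      linear_combination h1 - h2
  have hb := roots_bound' s k0 hk0 A B hB (fun k hk hd => by
    have := hS k hk hd
    rwa [hSk k hk, norm_neg] at this)
  rw [hSk 1 le_rfl, norm_neg]
  simp only [pow_one, Multiset.map_id']
  have h5 : ‖s.sum‖ ≤ (s.map (fun w => ‖w‖)).sum := by
    exact norm_multiset_sum_le s
  have h6 : (s.map (fun w => ‖w‖)).sum ≤ s.card * B := by
    have := Multiset.sum_le_card_nsmul (s.map (fun w => ‖w‖)) B (by
      intro x hx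
      obtain ⟨w, hw, rfl⟩ := Multiset.mem_map.1 hx
      exact hb w hw)
    simpa using this
  have h7 : (s.card : ℝ) ≤ (D : ℝ) - 1 := by
    have : s.card + 1 ≤ D := by omega
    have : (s.card : ℝ) + 1 ≤ D := by exact_mod_cast this
    linarith
  calc ‖s.sum‖ ≤ s.card * B := h5.trans h6
    _ ≤ _ := mul_le_mul_of_nonneg_right h7 hB.le
end analytic

end Part5

section Part6
open Polynomial

section Lfun
variable {K : Type*} [Field K] [Finite K]

theorem finite_monics (n : ℕ) : {a : K[X] | a.Monic ∧ a.natDegree = n}.Finite := by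
  have : Finite (degreeLT K (n + 1)) := Module.finite_of_finite K
  refine Set.Finite.subset (Set.toFinite (degreeLT K (n + 1) : Set K[X])) ?_
  rintro a ⟨_, ha⟩
  simp only [SetLike.mem_coe, mem_degreeLT]
  exact (degree_le_of_natDegree_le ha.le).trans_lt (by exact_mod_cast Nat.lt_succ_self n)

/-- monic polynomials of degree `n` -/
noncomputable def MP (K : Type*) [Field K] [Finite K] (n : ℕ) : Finset K[X] := (finite_monics (K := K) n).toFinset

theorem mem_MP {n : ℕ} {a : K[X]} : a ∈ MP K n ↔ a.Monic ∧ a.natDegree = n := by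
  simp [MP]

theorem finite_irr (n : ℕ) : {a : K[X] | a.Monic ∧ Irreducible a ∧ a.natDegree ≤ n}.Finite := by
  have : Finite (degreeLT K (n + 1)) := Module.finite_of_finite K
  refine Set.Finite.subset (Set.toFinite (degreeLT K (n + 1) : Set K[X])) ?_
  rintro a ⟨_, _, ha⟩
  simp only [SetLike.mem_coe, mem_degreeLT]
  exact (degree_le_of_natDegree_le ha).trans_lt (by exact_mod_cast Nat.lt_succ_self n)

/-- monic irreducibles of degree at most `n` -/
noncomputable def IP (K : Type*) [Field K] [Finite K] (n : ℕ) : Finset K[X] := (finite_irr (K := K) n).toFinset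

theorem mem_IP {n : ℕ} {a : K[X]} : a ∈ IP K n ↔ a.Monic ∧ Irreducible a ∧ a.natDegree ≤ n := by
  simp [IP]

/-- coefficients of the L-function -/
noncomputable def cL (χ : K[X] → ℂ) (n : ℕ) : ℂ := ∑ a ∈ MP K n, χ a

/-- coefficients of the logarithmic derivative -/
noncomputable def SL (χ : K[X] → ℂ) (k : ℕ) : ℂ :=
  ∑ P ∈ (IP K k).filter (fun P => P.natDegree ∣ k), (P.natDegree : ℂ) * χ P ^ (k / P.natDegree)

theorem cL_zero (χ : K[X] → ℂ) (h1 : χ 1 = 1) : cL χ 0 = 1 := by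
  have : MP K 0 = {1} := by
    ext a
    rw [mem_MP, Finset.mem_singleton]
    constructor
    · rintro ⟨h1, h2⟩; exact h1.natDegree_eq_zero.1 h2
    · rintro rfl; exact ⟨monic_one, natDegree_one⟩
  simp [cL, this, h1]

theorem cL_eq_zero (χ : K[X] → ℂ) (hmul : ∀ a b, χ (a * b) = χ a * χ b) (N : K[X]) (hN : N.Monic)
    (hper : ∀ a b, N ∣ a - b → χ a = χ b) (b0 : K[X]) (hb0 : IsCoprime b0 N) (hχ : χ b0 ≠ 1)
    (n : ℕ) (hn : N.natDegree ≤ n) : cL χ n = 0 := by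
  classical
  by_cases hN1 : N = 1
  · have h1 : ∀ a b, χ a = χ b := fun a b => hper a b (by rw [hN1]; exact one_dvd _)
    have h2 : ∀ a, χ a = 0 := by
      intro a
      have h3 := hmul 1 1
      rw [mul_one] at h3
      have h4 := h1 1 b0
      have h5 : χ b0 = 0 := by
        by_contra hne
        rw [h4] at h3
        exact hχ (mul_left_cancel₀ hne (by rw [← h3, mul_one]))
      rw [h1 a b0, h5]
    simp [cL, h2]
  set σ : K[X] → K[X] := fun a => N * (a /ₘ N) + (a * b0) %ₘ N with hσ
  have hdec : ∀ a : K[X], a - N * (a /ₘ N) = a %ₘ N := by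
    intro a
    have := modByMonic_add_div a N
    linear_combination -this
  have hσdiv : ∀ a, (σ a) /ₘ N = a /ₘ N ∧ (σ a) %ₘ N = (a * b0) %ₘ N := by
    intro a
    apply div_modByMonic_unique _ _ hN
    exact ⟨by rw [hσ]; ring, degree_modByMonic_lt _ hN⟩
  have hmaps : ∀ a ∈ MP K n, σ a ∈ MP K n := by
    intro a ha
    rw [mem_MP] at ha ⊢
    have hd : (σ a - a).degree < a.degree := by
      have : σ a - a = (a * b0) %ₘ N - a %ₘ N := by
        rw [← hdec a, hσ]; ring
      rw [this]
      refine (degree_sub_le _ _).trans_lt ?_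
      have hNa : N.degree ≤ a.degree := by
        rw [degree_eq_natDegree hN.ne_zero, degree_eq_natDegree ha.1.ne_zero, ha.2]
        exact_mod_cast hn
      exact (max_lt (degree_modByMonic_lt _ hN) (degree_modByMonic_lt _ hN)).trans_le hNa
    have he : σ a = a + (σ a - a) := by ring
    constructor
    · rw [he]; exact ha.1.add_of_left hd
    · rw [he, natDegree_add_eq_left_of_degree_lt hd, ha.2]
  have hinj : Set.InjOn σ (MP K n) := by
    intro a _ b _ hab
    have h1 := hσdiv a
    have h2 := hσdiv b
    rw [hab] at h1
    have h3 : a /ₘ N = b /ₘ N := h1.1.symm.trans h2.1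
    have h4 : (a * b0) %ₘ N = (b * b0) %ₘ N := h1.2.symm.trans h2.2
    have h5 : N ∣ (a - b) * b0 := by
      rw [← modByMonic_eq_zero_iff_dvd hN, sub_mul, sub_modByMonic, h4, sub_self]
    have h6 : N ∣ a - b := hb0.symm.dvd_of_dvd_mul_right h5
    rw [← modByMonic_eq_zero_iff_dvd hN, sub_modByMonic, sub_eq_zero] at h6
    rw [← modByMonic_add_div a N, ← modByMonic_add_div b N, h6, h3]
  have himg : (MP K n).image σ = MP K n := by
    apply Finset.eq_of_subset_of_card_le
    · intro x hx
      obtain ⟨a, ha, rfl⟩ := Finset.mem_image.1 hx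
      exact hmaps a ha
    · rw [Finset.card_image_of_injOn hinj]
  have h1 : cL χ n = cL χ n * χ b0 := by
    conv_lhs => rw [cL, ← himg, Finset.sum_image hinj]
    rw [cL, Finset.sum_mul]
    refine Finset.sum_congr rfl fun a _ => ?_
    rw [← hmul]
    apply hper
    rw [← modByMonic_eq_zero_iff_dvd hN, sub_modByMonic, (hσdiv a).2, sub_self]
  have h2 : cL χ n * (χ b0 - 1) = 0 := by linear_combination -h1
  exact (mul_eq_zero.1 h2).resolve_right (sub_ne_zero.2 hχ)

open Classical in
theorem degree_identity (n : ℕ) (a : K[X]) (ha : a ∈ MP K n) :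
    (n : ℂ) = ∑ P ∈ IP K n, ∑ j ∈ Finset.Icc 1 n, if P ^ j ∣ a then (P.natDegree : ℂ) else 0 := by
  rw [mem_MP] at ha
  have ha0 := ha.1.ne_zero
  set s := UniqueFactorizationMonoid.normalizedFactors a with hs
  have hprod : s.prod = a := by
    have := UniqueFactorizationMonoid.prod_normalizedFactors_eq ha0
    rw [this]
    exact ha.1.normalize_eq_self
  have hirr : ∀ P ∈ s, Irreducible P := fun P hP =>
    UniqueFactorizationMonoid.irreducible_of_normalized_factor P hP
  have hmon : ∀ P ∈ s, P.Monic := fun P hP => by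
    have h1 := UniqueFactorizationMonoid.normalize_normalized_factor P hP
    rw [← h1]
    exact monic_normalize (hirr P hP).ne_zero
  have hdeg : n = ∑ P ∈ s.toFinset, s.count P * P.natDegree := by
    rw [← ha.2]
    conv_lhs => rw [← hprod]
    rw [natDegree_multiset_prod_of_monic _ hmon, Finset.sum_multiset_map_count]
    simp
  have hsub : s.toFinset ⊆ IP K n := by
    intro P hP
    rw [Multiset.mem_toFinset] at hP
    rw [mem_IP]
    refine ⟨hmon P hP, hirr P hP, ?_⟩
    rw [← ha.2]
    exact natDegree_le_of_dvd (UniqueFactorizationMonoid.dvd_of_mem_normalizedFactors hP) ha0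
  have hcount : ∀ P ∈ IP K n, ∑ j ∈ Finset.Icc 1 n, (if P ^ j ∣ a then (P.natDegree : ℂ) else 0) =
      ((s.count P * P.natDegree : ℕ) : ℂ) := by
    intro P hP
    rw [mem_IP] at hP
    have hle : ∀ j, P ^ j ∣ a ↔ j ≤ s.count P := by
      intro j
      rw [← hP.1.normalize_eq_self] 
      have := UniqueFactorizationMonoid.emultiplicity_eq_count_normalizedFactors hP.2.1 ha0
      rw [hP.1.normalize_eq_self] at this ⊢
      rw [pow_dvd_iff_le_emultiplicity, this]
      exact_mod_cast Iff.rfl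
    have hcn : s.count P ≤ n := by
      have h1 : P ^ (s.count P) ∣ a := (hle _).2 le_rfl
      have h2 := natDegree_le_of_dvd h1 ha0
      rw [natDegree_pow, ha.2] at h2
      have h3 : 0 < P.natDegree := hP.2.1.natDegree_pos
      exact (Nat.le_mul_of_pos_right _ h3).trans h2
    rw [← Finset.sum_filter, Finset.sum_const, nsmul_eq_mul]
    have : (Finset.Icc 1 n).filter (fun j => P ^ j ∣ a) = Finset.Icc 1 (s.count P) := by
      ext j
      simp only [Finset.mem_filter, Finset.mem_Icc, hle]
      omega
    rw [this]
    simp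
  rw [Finset.sum_congr rfl hcount, ← Nat.cast_sum]
  congr 1
  rw [hdeg]
  conv_rhs => rw [← hdeg]
  apply Finset.sum_subset hsub
  intro P _ hP
  rw [Multiset.mem_toFinset] at hP
  rw [Multiset.count_eq_zero_of_notMem hP, zero_mul]

theorem sum_dvd (χ : K[X] → ℂ) (hmul : ∀ a b, χ (a * b) = χ a * χ b) (h1 : χ 1 = 1)
    (n j : ℕ) (P : K[X]) (hP : P.Monic) [DecidablePred fun a => P ^ j ∣ a] :
    ∑ a ∈ (MP K n).filter (fun a => P ^ j ∣ a), χ a =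
      if j * P.natDegree ≤ n then χ P ^ j * cL χ (n - j * P.natDegree) else 0 := by
  classical
  have hpow : ∀ j, χ (P ^ j) = χ P ^ j := by
    intro j
    induction j with
    | zero => simp [h1]
    | succ j ih => rw [pow_succ, hmul, ih, pow_succ]
  have hPj := hP.pow j
  split_ifs with h
  · rw [cL, Finset.mul_sum]
    refine (Finset.sum_bij (fun b _ => P ^ j * b) ?_ ?_ ?_ ?_).symm
    · intro b hb
      rw [mem_MP] at hb
      rw [Finset.mem_filter, mem_MP]
      refine ⟨⟨hPj.mul hb.1, ?_⟩, dvd_mul_right _ _⟩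
      rw [hPj.natDegree_mul hb.1, natDegree_pow, hb.2]
      omega
    · intro b _ c _ hbc
      exact mul_left_cancel₀ hPj.ne_zero hbc
    · intro a ha
      rw [Finset.mem_filter, mem_MP] at ha
      obtain ⟨⟨ha1, ha2⟩, b, rfl⟩ := ha
      have hb : b.Monic := hPj.of_mul_monic_left ha1
      refine ⟨b, ?_, rfl⟩
      rw [mem_MP]
      refine ⟨hb, ?_⟩
      rw [hPj.natDegree_mul hb, natDegree_pow] at ha2
      omega
    · intro b _
      rw [hmul, hpow]
  · apply Finset.sum_eq_zero
    intro a ha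
    rw [Finset.mem_filter, mem_MP] at ha
    exfalso
    apply h
    have := natDegree_le_of_dvd ha.2 ha.1.1.ne_zero
    rwa [natDegree_pow, ha.1.2] at this

theorem cL_rec (χ : K[X] → ℂ) (hmul : ∀ a b, χ (a * b) = χ a * χ b) (h1 : χ 1 = 1) (n : ℕ) :
    (n : ℂ) * cL χ n = ∑ k ∈ Finset.Icc 1 n, SL χ k * cL χ (n - k) := by
  classical
  have e1 : (n : ℂ) * cL χ n = ∑ P ∈ IP K n, ∑ j ∈ Finset.Icc 1 n,
      (P.natDegree : ℂ) * if j * P.natDegree ≤ n then χ P ^ j * cL χ (n - j * P.natDegree) else 0 := by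
    rw [cL, Finset.mul_sum]
    have : ∀ a ∈ MP K n, (n : ℂ) * χ a = ∑ P ∈ IP K n, ∑ j ∈ Finset.Icc 1 n,
        (if P ^ j ∣ a then (P.natDegree : ℂ) * χ a else 0) := by
      intro a ha
      rw [degree_identity n a ha, Finset.sum_mul]
      refine Finset.sum_congr rfl fun P _ => ?_
      rw [Finset.sum_mul]
      refine Finset.sum_congr rfl fun j _ => ?_
      split_ifs <;> simp
    rw [Finset.sum_congr rfl this, Finset.sum_comm]
    refine Finset.sum_congr rfl fun P hP => ?_
    rw [Finset.sum_comm]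
    refine Finset.sum_congr rfl fun j hj => ?_
    rw [← sum_dvd χ hmul h1 n j P (mem_IP.1 hP).1, ← Finset.sum_filter, Finset.mul_sum]
  have e2 : ∀ k ∈ Finset.Icc 1 n, SL χ k * cL χ (n - k) = ∑ P ∈ IP K n,
      (if P.natDegree ∣ k then (P.natDegree : ℂ) * χ P ^ (k / P.natDegree) * cL χ (n - k) else 0) := by
    intro k hk
    rw [Finset.mem_Icc] at hk
    have : (IP K k).filter (fun P => P.natDegree ∣ k) = (IP K n).filter (fun P => P.natDegree ∣ k) := by
      ext P
      simp only [Finset.mem_filter, mem_IP]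
      constructor
      · rintro ⟨⟨h1, h2, h3⟩, h4⟩; exact ⟨⟨h1, h2, by omega⟩, h4⟩
      · rintro ⟨⟨h1, h2, h3⟩, h4⟩; exact ⟨⟨h1, h2, Nat.le_of_dvd (by omega) h4⟩, h4⟩
    rw [SL, this, Finset.sum_mul, Finset.sum_filter]
  rw [e1, Finset.sum_congr rfl e2]
  conv_rhs => rw [Finset.sum_comm]
  refine Finset.sum_congr rfl fun P hP => ?_
  have hd : 0 < P.natDegree := (mem_IP.1 hP).2.1.natDegree_pos
  set d := P.natDegree with hdd
  rw [← Finset.sum_filter]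
  have : ∀ j ∈ Finset.Icc 1 n, ((d : ℂ) * if j * d ≤ n then χ P ^ j * cL χ (n - j * d) else 0) =
      if j * d ≤ n then (d : ℂ) * (χ P ^ j * cL χ (n - j * d)) else 0 := by
    intro j _
    split_ifs <;> simp
  rw [Finset.sum_congr rfl this, ← Finset.sum_filter]
  refine Finset.sum_nbij' (fun j => j * d) (fun k => k / d) ?_ ?_ ?_ ?_ ?_
  · intro j hj
    simp only [Finset.mem_filter, Finset.mem_Icc] at hj ⊢
    exact ⟨⟨Nat.mul_pos (by omega) hd, hj.2⟩, dvd_mul_left _ _⟩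
  · intro k hk
    simp only [Finset.mem_filter, Finset.mem_Icc] at hk ⊢
    refine ⟨⟨Nat.div_pos (Nat.le_of_dvd (by omega) hk.2) hd, (Nat.div_le_self _ _).trans hk.1.2⟩, ?_⟩
    rw [Nat.div_mul_cancel hk.2]; exact hk.1.2
  · intro j _
    exact Nat.mul_div_cancel _ hd
  · intro k hk
    exact Nat.div_mul_cancel (Finset.mem_filter.1 hk).2
  · intro j _
    rw [Nat.mul_div_cancel _ hd]; ring

theorem Lfun_bound (χ : K[X] → ℂ) (hmul : ∀ a b, χ (a * b) = χ a * χ b) (h1 : χ 1 = 1)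
    (N : K[X]) (hN : N.Monic) (hN1 : 1 ≤ N.natDegree)
    (hper : ∀ a b, N ∣ a - b → χ a = χ b) (b0 : K[X]) (hb0 : IsCoprime b0 N) (hχ : χ b0 ≠ 1)
    (k0 : ℕ) (hk0 : 1 ≤ k0) (A B : ℝ) (hB : 0 < B)
    (hS : ∀ k, 1 ≤ k → k0 ∣ k → ‖SL χ k‖ ≤ A * B ^ k) :
    ‖SL χ 1‖ ≤ ((N.natDegree : ℝ) - 1) * B :=
  newton_bound (cL χ) (SL χ) N.natDegree hN1 (cL_zero χ h1)
    (fun n hn => cL_eq_zero χ hmul N hN hper b0 hb0 hχ n hn) (cL_rec χ hmul h1) k0 hk0 A B hB hS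
end Lfun

end Part6

section Part7
open Polynomial IntermediateField

section fieldsum
variable {K : Type*} [Field K]

theorem aeval_ne_zero_of_coprime {E : Type*} [Field E] [Algebra K E] {a g : K[X]} (h : IsCoprime a g)
    {y : E} (hy : aeval y a = 0) : aeval y g ≠ 0 := by
  intro hg
  obtain ⟨u, v, huv⟩ := h
  have := congrArg (aeval y) huv
  simp [hy, hg] at this

theorem lam_eq_sum_roots {E : Type*} [Field E] [DecidableEq E] [Algebra K E] {g h P : K[X]}
    (hg : g.Monic) (hd : h.degree < g.degree) (hP : P.Monic) (hsep : P.Separable)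
    (hc : IsCoprime P g) (hs : (P.map (algebraMap K E)).Splits) :
    algebraMap K E (lam g h P) =
      ∑ y ∈ (P.aroots E).toFinset, (aeval y h / aeval y g) := by
  rw [← lam_map _ hg hc]
  have hnd : (P.aroots E).Nodup := nodup_roots hsep.map
  have h1 : P.map (algebraMap K E) = ∏ y ∈ (P.aroots E).toFinset, (X - C y) := by
    rw [Finset.prod_eq_multiset_prod, Multiset.toFinset_val, hnd.dedup]
    have := hs.eq_prod_roots
    rwa [(hP.map (algebraMap K E)).leadingCoeff, C_1, one_mul] at this
  have hne : ∀ y ∈ (P.aroots E).toFinset, (g.map (algebraMap K E)).eval y ≠ 0 := by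
    intro y hy
    rw [Multiset.mem_toFinset, mem_aroots] at hy
    rw [eval_map_algebraMap]
    exact aeval_ne_zero_of_coprime hc hy.2
  rw [h1, lam_prod (hg.map _)]
  · refine Finset.sum_congr rfl fun y hy => ?_
    rw [lam_linear (hg.map _) _ _ (hne y hy), eval_map_algebraMap, eval_map_algebraMap]
    simpa using hd
  · intro y hy
    have := (isCoprime_map (algebraMap K E)).2 hc
    refine this.of_isCoprime_of_dvd_left ?_
    rw [h1]
    exact Finset.dvd_prod_of_mem _ hy

theorem lam_minpoly [Finite K] {E : Type*} [Field E] [Algebra K E] [FiniteDimensional K E] {g h : K[X]}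
    (hg : g.Monic) (hd : h.degree < g.degree) (x : E) (hc : IsCoprime (minpoly K x) g) :
    Algebra.trace K E (aeval x h / aeval x g) =
      (Module.finrank K E / (minpoly K x).natDegree : ℕ) * lam g h (minpoly K x) := by
  classical
  have hx : IsIntegral K x := Algebra.IsIntegral.isIntegral x
  set y : K⟮x⟯ := aeval (AdjoinSimple.gen K x) h / aeval (AdjoinSimple.gen K x) g with hy
  have hyx : algebraMap K⟮x⟯ E y = aeval x h / aeval x g := by
    rw [hy, map_div₀, ← aeval_algebraMap_apply, ← aeval_algebraMap_apply,
      AdjoinSimple.algebraMap_gen]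
  have hfr : Module.finrank K⟮x⟯ E = Module.finrank K E / (minpoly K x).natDegree := by
    have h1 := Module.finrank_mul_finrank K K⟮x⟯ E
    rw [adjoin.finrank hx] at h1
    rw [← h1, Nat.mul_div_cancel_left _ (minpoly.natDegree_pos hx)]
  rw [← hyx, ← Algebra.trace_trace (S := K⟮x⟯), Algebra.trace_algebraMap, map_nsmul, hfr,
    nsmul_eq_mul]
  congr 1
  apply (algebraMap K (AlgebraicClosure K)).injective
  have hsep : (minpoly K x).Separable := Algebra.IsSeparable.isSeparable K x
  rw [lam_eq_sum_roots hg hd (minpoly.monic hx) hsep hc (IsAlgClosed.splits _),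
    trace_eq_sum_embeddings (AlgebraicClosure K)]
  have e := algHomAdjoinIntegralEquiv (K := AlgebraicClosure K) K hx
  rw [Finset.sum_subtype (p := fun z => z ∈ (minpoly K x).aroots (AlgebraicClosure K)) _
    (by intro z; rw [Multiset.mem_toFinset])]
  refine Fintype.sum_equiv (algHomAdjoinIntegralEquiv (K := AlgebraicClosure K) K hx) _ _ ?_
  intro σ
  have h2 : σ (AdjoinSimple.gen K x) =
      ((algHomAdjoinIntegralEquiv (K := AlgebraicClosure K) K hx) σ : AlgebraicClosure K) := by
    conv_lhs => rw [← (algHomAdjoinIntegralEquiv (K := AlgebraicClosure K) K hx).symm_apply_apply σ]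
    exact algHomAdjoinIntegralEquiv_symm_apply_gen K hx _
  rw [hy, map_div₀, ← aeval_algHom_apply, ← aeval_algHom_apply, h2]

theorem splits_of_dvd_finrank [Finite K] {E : Type*} [Field E] [Finite E] [Algebra K E]
    {P : K[X]} (hP : Irreducible P) (hdvd : P.natDegree ∣ Module.finrank K E) :
    (P.map (algebraMap K E)).Splits := by
  have : Fintype E := Fintype.ofFinite E
  have h1 := hP.natDegree_dvd_iff_dvd_X_pow_card_pow_sub_X.1 hdvd
  rw [← Module.natCard_eq_pow_finrank, ← Fintype.card_eq_nat_card] at h1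
  have := FiniteField.isSplittingField_sub E K
  have h2 := IsSplittingField.splits E (X ^ Fintype.card E - X : K[X])
  refine h2.of_dvd ?_ (Polynomial.map_dvd _ h1)
  exact map_ne_zero (FiniteField.X_pow_card_sub_X_ne_zero _ Fintype.one_lt_card)

open Classical in
/-- the multiplicative character attached to `h / g` -/
noncomputable def chi (p : ℕ) [Fact p.Prime] [Algebra (ZMod p) K] (g h a : K[X]) : ℂ :=
  if IsCoprime a g then ZMod.stdAddChar (Algebra.trace (ZMod p) K (lam g h a)) else 0

variable {p : ℕ} [Fact p.Prime] [Algebra (ZMod p) K]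

theorem chi_mul {g h : K[X]} (hg : g.Monic) (a b : K[X]) :
    chi p g h (a * b) = chi p g h a * chi p g h b := by
  unfold chi
  by_cases ha : IsCoprime a g
  · by_cases hb : IsCoprime b g
    · rw [if_pos ha, if_pos hb, if_pos (ha.mul_left hb), lam_mul hg ha hb, map_add, AddChar.map_add_eq_mul]
    · rw [if_neg hb, if_neg (fun h => hb h.of_mul_left_right), mul_zero]
  · rw [if_neg ha, if_neg (fun h => ha h.of_mul_left_left), zero_mul]

theorem chi_one {g h : K[X]} (hg : g.Monic) : chi p g h 1 = 1 := by
  unfold chi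
  rw [if_pos isCoprime_one_left, lam_one hg]
  simp

theorem chi_periodic {g h N : K[X]} (hg : g.Monic) (hN : g ∣ N) (hN' : g ∣ derivative N) (a b : K[X])
    (hab : N ∣ a - b) : chi p g h a = chi p g h b := by
  have hiff : IsCoprime a g ↔ IsCoprime b g := by
    obtain ⟨t, ht⟩ := hN.trans hab
    have : a = b + g * t := by linear_combination ht
    rw [this, IsCoprime.add_mul_left_left_iff]
  unfold chi
  by_cases ha : IsCoprime a g
  · rw [if_pos ha, if_pos (hiff.1 ha), lam_periodic hg hN hN' hab ha (hiff.1 ha)]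
  · rw [if_neg ha, if_neg (fun h => ha (hiff.2 h))]

theorem SL_eq_sum [Finite K] {E : Type*} [Field E] [Fintype E] [DecidableEq E] [Algebra K E]
    [Algebra (ZMod p) E] [IsScalarTower (ZMod p) K E] {g h : K[X]}
    (hg : g.Monic) (hd : h.degree < g.degree) :
    SL (chi p g h) (Module.finrank K E) = ∑ x : E, (if aeval x g = 0 then (0 : ℂ) else
      ZMod.stdAddChar (Algebra.trace (ZMod p) E (aeval x h / aeval x g))) := by
  classical
  have : FiniteDimensional K E := Module.Finite.of_finite
  have : Finite (ZMod p) := inferInstance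
  have : FiniteDimensional (ZMod p) K := Module.Finite.of_finite
  set n := Module.finrank K E with hn
  have hintegral : ∀ x : E, IsIntegral K x := fun x => Algebra.IsIntegral.isIntegral x
  have hmaps : ∀ x ∈ (Finset.univ : Finset E), minpoly K x ∈ (IP K n).filter (fun P => P.natDegree ∣ n) := by
    intro x _
    rw [Finset.mem_filter, mem_IP]
    have hdvd : (minpoly K x).natDegree ∣ n := by
      rw [hn, ← adjoin.finrank (hintegral x)]
      exact ⟨_, (Module.finrank_mul_finrank K K⟮x⟯ E).symm⟩
    exact ⟨⟨minpoly.monic (hintegral x), minpoly.irreducible (hintegral x),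
      Nat.le_of_dvd Module.finrank_pos hdvd⟩, hdvd⟩
  rw [← Finset.sum_fiberwise_of_maps_to hmaps, SL]
  refine Finset.sum_congr rfl fun P hP => ?_
  rw [Finset.mem_filter, mem_IP] at hP
  obtain ⟨⟨hPm, hPi, hPn⟩, hPd⟩ := hP
  have hsep : P.Separable := PerfectField.separable_of_irreducible hPi
  have hsplit := splits_of_dvd_finrank (E := E) hPi hPd
  have hfib : Finset.univ.filter (fun x : E => minpoly K x = P) = (P.aroots E).toFinset := by
    ext x
    rw [Finset.mem_filter, Multiset.mem_toFinset, mem_aroots]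
    constructor
    · rintro ⟨-, rfl⟩
      exact ⟨hPm.ne_zero, minpoly.aeval K x⟩
    · rintro ⟨-, hx⟩
      exact ⟨Finset.mem_univ _, (minpoly.eq_of_irreducible_of_monic hPi hx hPm).symm⟩
  have hcard : (Finset.univ.filter (fun x : E => minpoly K x = P)).card = P.natDegree := by
    rw [hfib, Multiset.toFinset_card_of_nodup (nodup_roots hsep.map),
      ← hsplit.natDegree_eq_card_roots, natDegree_map]
  rw [← nsmul_eq_mul]
  suffices hterm : ∀ x ∈ Finset.univ.filter (fun x : E => minpoly K x = P),
      (if aeval x g = 0 then (0 : ℂ) else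
      ZMod.stdAddChar (Algebra.trace (ZMod p) E (aeval x h / aeval x g))) =
      chi p g h P ^ (n / P.natDegree) by
    rw [Finset.sum_congr rfl hterm, Finset.sum_const, hcard]
  intro x hx
  symm
  have hxP : minpoly K x = P := (Finset.mem_filter.1 hx).2
  unfold chi
  by_cases hc : IsCoprime P g
  · rw [if_pos hc, if_neg (aeval_ne_zero_of_coprime hc (by rw [← hxP]; exact minpoly.aeval K x))]
    rw [← Algebra.trace_trace (S := K) (T := E), lam_minpoly hg hd x (by rw [hxP]; exact hc), hxP,
      ← nsmul_eq_mul, map_nsmul, AddChar.map_nsmul_eq_pow]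
  · rw [if_neg hc, if_pos, zero_pow]
    · rw [Nat.div_ne_zero_iff]
      exact ⟨hPi.natDegree_pos.ne', hPn⟩
    · have : P ∣ g := by
        by_contra h
        exact hc ((hPi.coprime_iff_not_dvd).2 h)
      obtain ⟨t, rfl⟩ := this
      rw [map_mul, ← hxP, minpoly.aeval, zero_mul]
end fieldsum

end Part7

section Part8
open Polynomial

section weil
variable {K : Type*} [Field K] [Fintype K] {p : ℕ} [Fact p.Prime] [Algebra (ZMod p) K]

theorem rootMult_aux {E : Type*} [Field E] [Algebra K E] {P u : K[X]} (hP : Irreducible P)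
    (hu : ¬ P ∣ u) (β : E) (hβ : aeval β P = 0) (n : ℕ) :
    ((P ^ n * u).map (algebraMap K E)).rootMultiplicity β = n := by
  have hsep : P.Separable := PerfectField.separable_of_irreducible hP
  have hroot : (P.map (algebraMap K E)).IsRoot β := by
    rw [IsRoot.def, eval_map_algebraMap, hβ]
  obtain ⟨w, hw⟩ := dvd_iff_isRoot.2 hroot
  have hsep' : (P.map (algebraMap K E)).Separable := hsep.map
  have hwβ : w.eval β ≠ 0 := by
    intro h0
    have h1 : (X - C β) * (X - C β) ∣ P.map (algebraMap K E) := by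
      rw [hw]; exact mul_dvd_mul_left _ (dvd_iff_isRoot.2 h0)
    have := hsep'.squarefree _ h1
    exact not_isUnit_X_sub_C β this
  have huβ : (u.map (algebraMap K E)).eval β ≠ 0 := by
    rw [eval_map_algebraMap]
    exact aeval_ne_zero_of_coprime ((hP.coprime_iff_not_dvd).2 hu) hβ
  have h2 : (P ^ n * u).map (algebraMap K E) = (w ^ n * u.map (algebraMap K E)) * (X - C β) ^ n := by
    rw [Polynomial.map_mul, Polynomial.map_pow, hw, mul_pow]; ring
  have h3 : (w ^ n * u.map (algebraMap K E)).eval β ≠ 0 := by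
    rw [eval_mul, eval_pow]; exact mul_ne_zero (pow_ne_zero _ hwβ) huβ
  have h4 : w ^ n * u.map (algebraMap K E) ≠ 0 := by
    intro h0; rw [h0] at h3; simp at h3
  rw [h2, rootMultiplicity_mul_X_sub_C_pow h4, rootMultiplicity_eq_zero h3, zero_add]

theorem SL_weak {g h P g' h' : K[X]} {a e : ℕ} (hg : g.Monic) (hd : h.degree < g.degree) (hP : Irreducible P)
    (eg : g = P ^ (a + e) * g') (eh : h = P ^ a * h') (hg' : ¬ P ∣ g') (hh' : ¬ P ∣ h') (he : ¬ p ∣ e)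
    (k : ℕ) (hk : 1 ≤ k) (hdvd : 2 * P.natDegree ∣ k) :
    ‖SL (chi p g h) k‖ ≤ wkC p g.natDegree * (Real.sqrt (Fintype.card K)) ^ k := by
  classical
  have : CharP K p := charP_of_injective_algebraMap (algebraMap (ZMod p) K).injective p
  have : NeZero k := ⟨by omega⟩
  have : Fintype (FiniteField.Extension K p k) := Fintype.ofFinite _
  have hfr := FiniteField.finrank_extension K p k
  have hsum := SL_eq_sum (E := FiniteField.Extension K p k) (p := p) hg hd
  rw [hfr] at hsum
  rw [hsum]
  obtain ⟨f, hp', hf⟩ := FiniteField.card K p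
  obtain ⟨j, rfl⟩ := (dvd_of_mul_right_dvd hdvd : 2 ∣ k)
  have hPj : P.natDegree ∣ 2 * j := dvd_of_mul_left_dvd hdvd
  have hj : 1 ≤ j := by omega
  have hsplit := splits_of_dvd_finrank (E := FiniteField.Extension K p (2 * j)) hP (by rw [hfr]; exact hPj)
  obtain ⟨β, hβ⟩ := hsplit.exists_eval_eq_zero (by
    rw [degree_map]; exact (degree_pos_of_irreducible hP).ne')
  rw [eval_map_algebraMap] at hβ
  have hh0 : h ≠ 0 := by
    intro h0
    apply hh'
    rw [eh] at h0
    rcases mul_eq_zero.1 h0 with h1 | h1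
    · exact absurd h1 (pow_ne_zero a hP.ne_zero)
    · rw [h1]; exact dvd_zero _
  have hcardE : Fintype.card (FiniteField.Extension K p (2 * j)) = (p ^ ((f : ℕ) * j)) ^ 2 := by
    rw [Fintype.card_eq_nat_card, FiniteField.natCard_extension, Nat.card_eq_fintype_card, hf]
    ring
  have hl : p ^ ((f : ℕ) * j) = p * p ^ ((f : ℕ) * j - 1) := by
    rw [← pow_succ']
    congr 1
    have : 0 < (f : ℕ) * j := Nat.mul_pos f.pos hj
    omega
  have hsq : (Real.sqrt (Fintype.card K)) ^ (2 * j) = (p : ℝ) ^ ((f : ℕ) * j) := by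
    rw [pow_mul, Real.sq_sqrt (Nat.cast_nonneg _), hf]
    push_cast
    rw [← pow_mul]
  have key := weak_bound (E := FiniteField.Extension K p (2 * j)) (p := p) ((f : ℕ) * j) _ e g.natDegree
    hl hcardE (h.map (algebraMap K _)) (g.map (algebraMap K _)) (map_ne_zero hh0)
    (map_ne_zero hg.ne_zero)
    (by rw [natDegree_map]; exact natDegree_le_natDegree hd.le) (by rw [natDegree_map]) β
    (by
      rw [eg, eh, rootMult_aux hP hg' β hβ, rootMult_aux hP hh' β hβ]) he
  simp only [eval_map_algebraMap] at key
  rw [hsq]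
  convert key

theorem weil_bound [DecidableEq K] {g h P g' h' ρ : K[X]} {a e : ℕ} (hg : g.Monic) (hd : h.degree < g.degree)
    (hP : Irreducible P)
    (eg : g = P ^ (a + e) * g') (eh : h = P ^ a * h') (hg' : ¬ P ∣ g') (hh' : ¬ P ∣ h') (he : ¬ p ∣ e)
    (hρ : ρ.Monic) (hρg : ρ ∣ g) (hρ' : g ∣ derivative (g * ρ)) :
    ‖∑ x : K, (if g.eval x = 0 then (0 : ℂ) else
      ZMod.stdAddChar (Algebra.trace (ZMod p) K (h.eval x / g.eval x)))‖ ≤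
      ((g.natDegree : ℝ) + ρ.natDegree - 1) * Real.sqrt (Fintype.card K) := by
  classical
  have hsum := SL_eq_sum (E := K) (p := p) hg hd
  rw [Module.finrank_self] at hsum
  simp only [coe_aeval_eq_eval] at hsum
  have e0 : 0 < e := Nat.pos_of_ne_zero (by rintro rfl; exact he (dvd_zero _))
  have hN : (g * ρ).Monic := hg.mul hρ
  have hNd : (g * ρ).natDegree = g.natDegree + ρ.natDegree := hg.natDegree_mul hρ
  have hgd : 1 ≤ g.natDegree := by
    have h1 : P ∣ g := by rw [eg]; exact (dvd_pow_self P (by omega)).mul_right _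
    exact hP.natDegree_pos.trans_le (natDegree_le_of_dvd h1 hg.ne_zero)
  have hcop : ∀ b, IsCoprime b g → IsCoprime b (g * ρ) := fun b hb =>
    hb.mul_right (hb.of_isCoprime_of_dvd_right hρg)
  have hQ : 1 < Real.sqrt (Fintype.card K) := by
    rw [Real.lt_sqrt zero_le_one]
    simpa using Fintype.one_lt_card (α := K)
  set B := Real.sqrt (Fintype.card K) with hB
  have hw := fun k hk hdvd => SL_weak (p := p) hg hd hP eg eh hg' hh' he k hk hdvd
  have hk0 : 1 ≤ 2 * P.natDegree := by have := hP.natDegree_pos; omega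
  obtain ⟨b0, hb0, hχ⟩ : ∃ b0, IsCoprime b0 (g * ρ) ∧ chi p g h b0 ≠ 1 := by
    by_contra hcon
    push Not at hcon
    have hchi : chi p g h = chi p g 0 := by
      funext b
      by_cases hb : IsCoprime b g
      · rw [hcon b (hcop b hb)]
        simp [chi, hb, lam, lamI]
      · simp [chi, hb]
    have hchar : CharP K p := charP_of_injective_algebraMap (algebraMap (ZMod p) K).injective p
    have hbig : ∀ k, 1 ≤ k → 2 * P.natDegree ∣ k →
        (B ^ k) ^ 2 - g.natDegree ≤ wkC p g.natDegree * B ^ k := by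
      intro k hk hdvd
      refine le_trans ?_ (hw k hk hdvd)
      have : NeZero k := ⟨by omega⟩
      have : Fintype (FiniteField.Extension K p k) := Fintype.ofFinite _
      have h1 := SL_eq_sum (E := FiniteField.Extension K p k) (p := p) (g := g) (h := 0) hg
        (by simpa using bot_lt_iff_ne_bot.2 (degree_ne_bot.2 hg.ne_zero))
      rw [FiniteField.finrank_extension] at h1
      rw [hchi, h1]
      simp only [map_zero, zero_div, AddChar.map_zero_eq_one]
      have h2 : ∑ x : FiniteField.Extension K p k, (if aeval x g = 0 then (0 : ℂ) else 1) =
          ((Finset.univ.filter (fun x : FiniteField.Extension K p k => ¬ aeval x g = 0)).card : ℂ) := by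
        rw [Finset.card_filter]
        push_cast
        refine Finset.sum_congr rfl fun x _ => ?_
        by_cases hx : aeval x g = 0 <;> simp [hx]
      rw [h2, Complex.norm_natCast]
      have h3 : (Finset.univ.filter (fun x : FiniteField.Extension K p k => aeval x g = 0)).card ≤ g.natDegree := by
        have : (Finset.univ.filter (fun x : FiniteField.Extension K p k => aeval x g = 0)) ⊆
            (g.aroots (FiniteField.Extension K p k)).toFinset := by
          intro x hx
          rw [Multiset.mem_toFinset, mem_aroots]
          exact ⟨hg.ne_zero, (Finset.mem_filter.1 hx).2⟩
        refine (Finset.card_le_card this).trans ((Multiset.toFinset_card_le _).trans ?_)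
        exact (card_roots' _).trans (by rw [natDegree_map])
      have h4 := Finset.card_filter_add_card_filter_not (s := (Finset.univ : Finset (FiniteField.Extension K p k)))
        (fun x => aeval x g = 0)
      rw [Finset.card_univ, Fintype.card_eq_nat_card, FiniteField.natCard_extension,
        Nat.card_eq_fintype_card] at h4
      have h5 : (B ^ k) ^ 2 = ((Fintype.card K ^ k : ℕ) : ℝ) := by
        rw [← pow_mul, mul_comm, pow_mul, hB, Real.sq_sqrt (Nat.cast_nonneg _)]
        push_cast; rfl
      rw [h5, ← h4]
      push_cast
      have : ((Finset.univ.filter (fun x : FiniteField.Extension K p k => aeval x g = 0)).card : ℝ) ≤ g.natDegree := by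
        exact_mod_cast h3
      linarith
    obtain ⟨t, ht⟩ := pow_unbounded_of_one_lt ((wkC p g.natDegree : ℝ) + g.natDegree)
      (one_lt_pow₀ hQ (by omega : 2 * P.natDegree ≠ 0))
    have ht' : (wkC p g.natDegree : ℝ) + g.natDegree < (B ^ (2 * P.natDegree)) ^ (t + 1) :=
      ht.trans_le (pow_le_pow_right₀ (one_lt_pow₀ hQ (by omega)).le (by omega))
    rw [← pow_mul] at ht'
    have h6 := hbig (2 * P.natDegree * (t + 1)) (Nat.mul_pos hk0 (by omega)) (dvd_mul_right _ _)
    have h7 : 1 ≤ B ^ (2 * P.natDegree * (t + 1)) := one_le_pow₀ hQ.le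
    set x := B ^ (2 * P.natDegree * (t + 1)) with hx
    have h8 : (0 : ℝ) ≤ g.natDegree := Nat.cast_nonneg _
    nlinarith
  have hmain := Lfun_bound (chi p g h) (chi_mul hg) (chi_one hg) (g * ρ) hN (by rw [hNd]; omega)
    (chi_periodic hg (dvd_mul_right _ _) hρ') b0 hb0 hχ (2 * P.natDegree) hk0 _ B (by linarith) hw
  rw [hsum, hNd] at hmain
  push_cast at hmain
  refine le_trans (le_of_eq ?_) hmain
  congr 1
end weil

end Part8

section Part9
open Polynomial

theorem as_identity {M : Type*} [Field M] (p k : ℕ) (hk : p = k + 2) (a c b' y : M) (hy : y ≠ 0) (hb' : b' ≠ 0) :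
    (a - c ^ p * b' + c * y ^ (k + 1) * b') / (y ^ p * b') =
      a / (y ^ p * b') - ((c / y) ^ p - c / y) := by
  rw [hk, div_pow]
  field_simp
  ring

section core
variable {K : Type*} [Field K] [Fintype K] {p : ℕ} [Fact p.Prime] [Algebra (ZMod p) K]

theorem natDegree_le_ncard {g ρ : K[X]} (hg : g ≠ 0) (hρ : Squarefree ρ) (hd : ρ ∣ g) :
    ρ.natDegree ≤ {x : AlgebraicClosure K | aeval x g = 0}.ncard := by
  have hsep : ρ.Separable := PerfectField.separable_iff_squarefree.2 hρ
  have h1 := card_rootSet_eq_natDegree (K := AlgebraicClosure K) hsep (IsAlgClosed.splits _)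
  rw [← h1, ← Nat.card_eq_fintype_card, Nat.card_coe_set_eq]
  have hfin : {x : AlgebraicClosure K | aeval x g = 0}.Finite := by
    refine (rootSet_finite g (AlgebraicClosure K)).subset fun x hx => ?_
    exact (mem_rootSet.2 ⟨hg, hx⟩)
  refine Set.ncard_le_ncard (fun x hx => ?_) hfin
  obtain ⟨w, rfl⟩ := hd
  have := (mem_rootSet.1 hx).2
  simp [this]

theorem weil_contra {g h P g' h' : K[X]} {a e : ℕ} (hg0 : g ≠ 0) (hd : h.degree < g.degree)
    (hP : Irreducible P)
    (eg : g = P ^ (a + e) * g') (eh : h = P ^ a * h') (hg' : ¬ P ∣ g') (hh' : ¬ P ∣ h') (he : ¬ p ∣ e)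
    (hz : ∀ x : K, g.eval x ≠ 0)
    (ht : ∀ x : K, Algebra.trace (ZMod p) K (h.eval x / g.eval x) = 0)
    (hb : ((g.natDegree : ℝ) + 2 * ({x : AlgebraicClosure K | aeval x g = 0}.ncard : ℝ) - 2) *
      Real.sqrt (Fintype.card K) < Fintype.card K + 1) : False := by
  classical
  have hl : g.leadingCoeff ≠ 0 := leadingCoeff_ne_zero.2 hg0
  set c := g.leadingCoeff⁻¹ with hc
  have hc0 : c ≠ 0 := inv_ne_zero hl
  have hmon : (C c * g).Monic := by
    rw [Monic, leadingCoeff_mul, leadingCoeff_C, hc, inv_mul_cancel₀ hl]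
  have hu : IsUnit (C c) := isUnit_C.2 (isUnit_iff_ne_zero.2 hc0)
  obtain ⟨ρ, hρ, hsq, hρg, hρ'⟩ := exists_radical (C c * g) hmon.ne_zero
  have e0 : e ≠ 0 := by rintro rfl; exact he (dvd_zero _)
  have hW := weil_bound (p := p) (g := C c * g) (h := C c * h) (P := P) (g' := C c * g')
    (h' := C c * h') (a := a) (e := e) (ρ := ρ) hmon
    (by rwa [degree_C_mul hc0, degree_C_mul hc0]) hP
    (by rw [eg]; ring) (by rw [eh]; ring) (by rwa [hu.dvd_mul_left]) (by rwa [hu.dvd_mul_left])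
    he hρ hρg hρ'
  have hsum : ∑ x : K, (if (C c * g).eval x = 0 then (0 : ℂ) else
      ZMod.stdAddChar (Algebra.trace (ZMod p) K ((C c * h).eval x / (C c * g).eval x))) =
      (Fintype.card K : ℂ) := by
    rw [Finset.sum_congr rfl (g := fun _ => (1 : ℂ))]
    · simp
    · intro x _
      rw [eval_mul, eval_mul, eval_C, if_neg (mul_ne_zero hc0 (hz x)), mul_div_mul_left _ _ hc0, ht x,
        AddChar.map_zero_eq_one]
  rw [hsum, Complex.norm_natCast, natDegree_C_mul hc0] at hW
  have h1 := natDegree_le_ncard hg0 hsq ((hu.dvd_mul_left).1 hρg)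
  have hPg : P ∣ g := by rw [eg]; exact (dvd_pow_self P (by omega)).mul_right _
  have h2 := natDegree_le_ncard hg0 hP.squarefree hPg
  have h3 : 2 ≤ P.natDegree := by
    have h4 := hP.natDegree_pos
    by_contra h5
    have h6 : P.degree = 1 := by
      rw [degree_eq_natDegree hP.ne_zero]
      have : P.natDegree = 1 := by omega
      rw [this]; rfl
    obtain ⟨x, hx⟩ := exists_root_of_degree_eq_one h6
    exact hz x (hx.dvd hPg)
  set s := {x : AlgebraicClosure K | aeval x g = 0}.ncard
  have h1' : (ρ.natDegree : ℝ) ≤ s := by exact_mod_cast h1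
  have h2' : (2 : ℝ) ≤ s := by exact_mod_cast h3.trans h2
  have hQ : 1 ≤ Real.sqrt (Fintype.card K) := by
    rw [Real.one_le_sqrt]
    exact_mod_cast Fintype.card_pos (α := K)
  nlinarith

theorem exists_pth_root_mod {P : K[X]} (hP : Irreducible P) {a b : K[X]} (hb : ¬ P ∣ b) :
    ∃ c : K[X], c.degree < P.degree ∧ P ∣ a - c ^ p * b := by
  have := Fact.mk hP
  have hchar : CharP K p := charP_of_injective_algebraMap (algebraMap (ZMod p) K).injective p
  have : CharP (AdjoinRoot P) p := charP_of_injective_algebraMap (algebraMap K (AdjoinRoot P)).injective p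
  have : Module.Finite K (AdjoinRoot P) := (AdjoinRoot.powerBasis hP.ne_zero).finite
  have : Finite (AdjoinRoot P) := Module.finite_of_finite K
  have hb' : AdjoinRoot.mk P b ≠ 0 := by rwa [Ne, AdjoinRoot.mk_eq_zero]
  have hbij : Function.Surjective (frobenius (AdjoinRoot P) p) :=
    Finite.surjective_of_injective (frobenius_inj _ p)
  obtain ⟨y, hy⟩ := hbij (AdjoinRoot.mk P a / AdjoinRoot.mk P b)
  obtain ⟨c, rfl⟩ := AdjoinRoot.mk_surjective y
  refine ⟨c % P, EuclideanDomain.mod_lt _ hP.ne_zero, ?_⟩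
  have hcm : AdjoinRoot.mk P (c % P) = AdjoinRoot.mk P c := by
    rw [AdjoinRoot.mk_eq_mk, ← dvd_neg, neg_sub]
    exact ⟨c / P, by rw [sub_eq_iff_eq_add]; exact (EuclideanDomain.div_add_mod c P).symm⟩
  rw [← AdjoinRoot.mk_eq_zero, map_sub, map_mul, map_pow, hcm]
  rw [frobenius_def] at hy
  rw [hy, div_mul_cancel₀ _ hb', sub_self]

theorem reduce_core {L : Type*} [Field L] [Algebra K[X] L] [IsFractionRing K[X] L] {g : K[X]} (hg0 : g ≠ 0)
    (hz : ∀ x : K, g.eval x ≠ 0)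
    (hb : ((g.natDegree : ℝ) + 2 * ({x : AlgebraicClosure K | aeval x g = 0}.ncard : ℝ) - 2) *
      Real.sqrt (Fintype.card K) < Fintype.card K + 1) :
    ∀ (n : ℕ) (a b : K[X]), b.natDegree ≤ n → b ∣ g → a.degree < b.degree →
      (∀ x : K, Algebra.trace (ZMod p) K (a.eval x / b.eval x) = 0) →
      ∃ u : L, algebraMap K[X] L a / algebraMap K[X] L b = u ^ p - u := by
  have hp := Fact.out (p := p.Prime)
  have hchar : CharP K p := charP_of_injective_algebraMap (algebraMap (ZMod p) K).injective p
  have hinj := IsFractionRing.injective K[X] L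
  have hne : ∀ w : K[X], w ≠ 0 → algebraMap K[X] L w ≠ 0 := fun w hw => by
    rwa [Ne, map_eq_zero_iff _ hinj]
  have : CharP L p := by
    have : CharP K[X] p := inferInstance
    exact charP_of_injective_algebraMap hinj p
  intro n
  induction n with
  | zero =>
    intro a b hn hbg hab _
    have hb0 : b ≠ 0 := ne_zero_of_dvd_ne_zero hg0 hbg
    have : a = 0 := by
      rw [degree_eq_natDegree hb0, Nat.le_zero.1 hn] at hab
      exact degree_eq_bot.1 (Nat.WithBot.lt_zero_iff.1 hab)
    refine ⟨0, ?_⟩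
    simp [this, hp.ne_zero]
  | succ n ih =>
    intro a b hn hbg hab ht
    have hb0 : b ≠ 0 := ne_zero_of_dvd_ne_zero hg0 hbg
    have hzd : ∀ w, w ∣ g → ∀ x : K, w.eval x ≠ 0 := by
      rintro w ⟨v, rfl⟩ x hx
      apply hz x
      rw [eval_mul, hx, zero_mul]
    -- cancelling an irreducible factor
    have hcancel : ∀ P a' b' : K[X], Irreducible P → b = P * b' → (P * a').degree < b.degree →
        (∀ x : K, Algebra.trace (ZMod p) K ((P * a').eval x / b.eval x) = 0) →
        ∃ u : L, algebraMap K[X] L (P * a') / algebraMap K[X] L b = u ^ p - u := by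
      intro P a' b' hP eb hdeg htr
      have hb'0 : b' ≠ 0 := by rintro rfl; apply hb0; rw [eb, mul_zero]
      have hPg : P ∣ g := (Dvd.intro _ eb.symm).trans hbg
      have hb'g : b' ∣ g := (Dvd.intro_left _ eb.symm).trans hbg
      obtain ⟨u, hu⟩ := ih a' b' (by
          rw [eb, natDegree_mul hP.ne_zero hb'0] at hn
          have := hP.natDegree_pos
          omega) hb'g
        (by
          rw [eb, degree_mul, degree_mul] at hdeg
          exact lt_of_add_lt_add_left hdeg)
        (fun x => by
          have h1 := htr x
          rwa [eb, eval_mul, eval_mul, mul_div_mul_left _ _ (hzd P hPg x)] at h1)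
      refine ⟨u, ?_⟩
      rw [← hu, eb, map_mul, map_mul, mul_div_mul_left _ _ (hne P hP.ne_zero)]
    by_cases hbu : IsUnit b
    · exact ih a b (by rw [natDegree_eq_zero_of_isUnit hbu]; omega) hbg hab ht
    obtain ⟨P, hP, hPb⟩ := WfDvdMonoid.exists_irreducible_factor hbu hb0
    have hPg : P ∣ g := hPb.trans hbg
    by_cases hPa : P ∣ a
    · obtain ⟨a', rfl⟩ := hPa
      obtain ⟨b', hb'⟩ := hPb
      exact hcancel P a' b' hP hb' hab ht
    have hfm : FiniteMultiplicity P b := FiniteMultiplicity.of_not_isUnit hP.not_isUnit hb0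
    obtain ⟨b', hb', hPb'⟩ := hfm.exists_eq_pow_mul_and_not_dvd
    set e := multiplicity P b with he
    by_cases hpe : p ∣ e
    · obtain ⟨f, hf⟩ := hpe
      have hb'0 : b' ≠ 0 := by rintro rfl; apply hb0; rw [hb', mul_zero]
      have hf0 : 1 ≤ f := by
        by_contra h0
        have : f = 0 := by omega
        rw [hf, this, mul_zero, pow_zero, one_mul] at hb'
        exact hPb' (hb' ▸ hPb)
      obtain ⟨c, hcd, hcP⟩ := exists_pth_root_mod (p := p) hP (a := a) hPb'
      obtain ⟨k, hk⟩ : ∃ k, p = k + 2 := ⟨p - 2, by have := hp.two_le; omega⟩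
      have hbE : b = (P ^ f) ^ p * b' := by rw [hb', hf, ← pow_mul, mul_comm p f]
      -- new numerator
      set N := a - c ^ p * b' + c * (P ^ f) ^ (k + 1) * b' with hN
      have hPN : P ∣ N := by
        refine dvd_add hcP ?_
        refine Dvd.dvd.mul_right (Dvd.dvd.mul_left ?_ _) _
        exact (dvd_pow_self P (by omega)).trans (dvd_pow_self _ (by omega))
      have hcPf : c.degree < (P ^ f).degree := by
        refine hcd.trans_le (degree_le_of_dvd (dvd_pow_self P (by omega)) (pow_ne_zero _ hP.ne_zero))
      have hPf0 : P ^ f ≠ 0 := pow_ne_zero _ hP.ne_zero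
      have hNd : N.degree < b.degree := by
        refine (degree_add_le _ _).trans_lt (max_lt ((degree_sub_le _ _).trans_lt (max_lt hab ?_)) ?_)
        · by_cases hc0 : c = 0
          · rw [hc0, zero_pow hp.ne_zero, zero_mul, degree_zero]
            exact bot_lt_iff_ne_bot.2 (degree_ne_bot.2 hb0)
          · rw [hbE]
            have h1 := natDegree_lt_natDegree hc0 hcPf
            apply degree_lt_degree
            rw [natDegree_mul (pow_ne_zero _ hc0) hb'0, natDegree_mul (pow_ne_zero _ hPf0) hb'0,
              natDegree_pow, natDegree_pow _ p]
            have := Nat.mul_lt_mul_of_pos_left h1 hp.pos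
            omega
        · by_cases hc0 : c = 0
          · rw [hc0, zero_mul, zero_mul, degree_zero]
            exact bot_lt_iff_ne_bot.2 (degree_ne_bot.2 hb0)
          · rw [hbE]
            have h1 := natDegree_lt_natDegree hc0 hcPf
            apply degree_lt_degree
            rw [natDegree_mul (mul_ne_zero hc0 (pow_ne_zero _ hPf0)) hb'0,
              natDegree_mul hc0 (pow_ne_zero _ hPf0), natDegree_mul (pow_ne_zero _ hPf0) hb'0,
              natDegree_pow, natDegree_pow _ p]
            have : p * (P ^ f).natDegree = (k + 1) * (P ^ f).natDegree + (P ^ f).natDegree := by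
              rw [hk]; ring
            omega
      have hNt : ∀ x : K, Algebra.trace (ZMod p) K (N.eval x / b.eval x) = 0 := by
        intro x
        have hbx := hzd b hbg x
        have hPx : (P ^ f).eval x ≠ 0 := by rw [eval_pow]; exact pow_ne_zero _ (hzd P hPg x)
        have hb'x : b'.eval x ≠ 0 := hzd b' ((Dvd.intro_left _ hb'.symm).trans hbg) x
        have h1 : N.eval x / b.eval x = a.eval x / b.eval x -
            ((c.eval x / (P ^ f).eval x) ^ p - c.eval x / (P ^ f).eval x) := by
          rw [hbE, hN]
          simp only [eval_add, eval_sub, eval_mul, eval_pow] at hPx ⊢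
          exact as_identity p k hk _ _ _ _ hPx hb'x
        rw [h1, map_sub, ht x, map_sub]
        have h2 : ∀ y : K, Algebra.trace (ZMod p) K (y ^ p) = Algebra.trace (ZMod p) K y := by
          intro y
          have := Algebra.trace_eq_of_algEquiv (FiniteField.frobeniusAlgEquivOfAlgebraic (ZMod p) K) y
          simpa [ZMod.card] using this
        rw [h2, sub_self, sub_zero]
      obtain ⟨N', hN'⟩ := hPN
      obtain ⟨b'', hb''⟩ := hPb
      obtain ⟨u, hu⟩ := hcancel P N' b'' hP hb'' (hN' ▸ hNd) (hN' ▸ hNt)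
      rw [← hN'] at hu
      have h3 : algebraMap K[X] L N / algebraMap K[X] L b = algebraMap K[X] L a / algebraMap K[X] L b -
          ((algebraMap K[X] L c / algebraMap K[X] L (P ^ f)) ^ p -
            algebraMap K[X] L c / algebraMap K[X] L (P ^ f)) := by
        rw [hbE, hN]
        have hPf := hne _ hPf0
        simp only [map_add, map_sub, map_mul, map_pow] at hPf ⊢
        exact as_identity p k hk _ _ _ _ hPf (hne _ hb'0)
      refine ⟨u + algebraMap K[X] L c / algebraMap K[X] L (P ^ f), ?_⟩
      rw [add_pow_char, add_sub_add_comm, ← hu, h3]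
      ring
    · exfalso
      obtain ⟨w, hw⟩ := hbg
      have hw0 : w ≠ 0 := by rintro rfl; apply hg0; rw [hw, mul_zero]
      have hfm' : FiniteMultiplicity P w := FiniteMultiplicity.of_not_isUnit hP.not_isUnit hw0
      obtain ⟨w', hw', hPw'⟩ := hfm'.exists_eq_pow_mul_and_not_dvd
      refine weil_contra (p := p) (g := g) (h := a * w) (P := P) (g' := b' * w') (h' := a * w')
        (a := multiplicity P w) (e := e) hg0 ?_ hP ?_ ?_ ?_ ?_ hpe hz ?_ hb
      · rw [hw, degree_mul, degree_mul]
        exact WithBot.add_lt_add_right (degree_ne_bot.2 hw0) hab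
      · rw [hw]
        conv_lhs => rw [hb', hw']
        ring
      · conv_lhs => rw [hw']
        ring
      · exact fun hc => (hP.prime.dvd_or_dvd hc).elim hPb' hPw'
      · exact fun hc => (hP.prime.dvd_or_dvd hc).elim hPa hPw'
      · intro x
        rw [hw, eval_mul, eval_mul, mul_div_mul_right _ _ (hzd w (Dvd.intro_left _ hw.symm) x)]
        exact ht x

end core

end Part9

section Part10
open Polynomial

section assembly

theorem sum_inv_mul_pow {F : Type*} [Field F] [Fintype F] {n : ℕ} (hn : 1 ≤ n) (hn' : n < Fintype.card F) :
    ∑ c : F, c⁻¹ * c ^ n = if n = 1 then -1 else 0 := by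
  classical
  obtain ⟨k, rfl⟩ : ∃ k, n = k + 1 := ⟨n - 1, by omega⟩
  by_cases hk : k = 0
  · subst hk
    have h1 : ∀ c : F, c⁻¹ * c ^ (0 + 1) = 1 - if c = 0 then 1 else 0 := by
      intro c
      by_cases hc : c = 0 <;> simp [hc]
    rw [Finset.sum_congr rfl fun c _ => h1 c, Finset.sum_sub_distrib]
    simp
  · rw [if_neg (by omega), ← FiniteField.sum_pow_lt_card_sub_one F k (by omega)]
    refine Finset.sum_congr rfl fun c _ => ?_
    by_cases hc : c = 0
    · simp [hc, hk]
    · rw [pow_succ, mul_comm, mul_assoc, mul_inv_cancel₀ hc, mul_one]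

theorem exists_q_root {F L : Type*} [Field F] [Fintype F] [Field L] (p r : ℕ) [Fact p.Prime] [CharP L p]
    (hr : 1 ≤ r) (hF : Fintype.card F = p ^ r) (φ : F →+* L) (f : L)
    (hf : ∀ c : F, ∃ u : L, φ c * f = u ^ p - u) : ∃ v : L, v ^ p ^ r - v = f := by
  have hp := Fact.out (p := p.Prime)
  choose u hu using hf
  have hpow : ∀ (c : F) (j : ℕ), u c ^ p ^ j = u c + ∑ i ∈ Finset.range j, (φ c * f) ^ p ^ i := by
    intro c j
    induction j with
    | zero => simp
    | succ j ih =>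
      rw [Finset.sum_range_succ', pow_zero, pow_one, pow_succ, pow_mul, ih, add_pow_char, sum_pow_char p]
      have : u c ^ p = u c + φ c * f := by rw [hu c]; ring
      rw [this]
      simp only [← pow_mul, ← pow_succ]
      ring
  refine ⟨-∑ c : F, φ c⁻¹ * u c, ?_⟩
  have hneg : (-∑ c : F, φ c⁻¹ * u c) ^ p ^ r = - ∑ c : F, (φ c⁻¹ * u c) ^ p ^ r := by
    rw [← sum_pow_char_pow p r, ← zero_sub, sub_pow_char_pow, zero_pow (pow_ne_zero _ hp.ne_zero), zero_sub]
  have hterm : ∀ c : F, (φ c⁻¹ * u c) ^ p ^ r = φ c⁻¹ * u c +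
      ∑ i ∈ Finset.range r, φ (c⁻¹ * c ^ p ^ i) * f ^ p ^ i := by
    intro c
    rw [mul_pow, ← map_pow, ← hF, FiniteField.pow_card, hF, hpow, mul_add, Finset.mul_sum]
    congr 1
    refine Finset.sum_congr rfl fun i _ => ?_
    rw [mul_pow, map_mul, map_pow, mul_assoc]
  rw [hneg, Finset.sum_congr rfl fun c _ => hterm c, Finset.sum_add_distrib, Finset.sum_comm]
  have hin : ∀ i ∈ Finset.range r, ∑ c : F, φ (c⁻¹ * c ^ p ^ i) * f ^ p ^ i =
      if i = 0 then -f else 0 := by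
    intro i hi
    rw [← Finset.sum_mul, ← map_sum, sum_inv_mul_pow (Nat.one_le_pow _ _ hp.pos)
      (by rw [hF]; exact Nat.pow_lt_pow_right hp.one_lt (Finset.mem_range.1 hi))]
    by_cases h0 : i = 0
    · simp [h0]
    · rw [if_neg h0, if_neg (by
        intro h1
        rcases Nat.pow_eq_one.1 h1 with h2 | h2
        · exact hp.one_lt.ne' h2
        · exact h0 h2)]
      simp
  rw [Finset.sum_congr rfl hin, Finset.sum_ite_eq', if_pos (Finset.mem_range.2 (by omega))]
  ring

variable {K : Type*} [Field K]

theorem dvd_of_pow_dvd_qfree {q : ℕ} {B g₁ g₂ : K[X]} (hB : B ≠ 0)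
    (hqfree : ¬ ∃ w : K[X], 0 < w.natDegree ∧ w ^ q ∣ g₂) (h : B ^ q ∣ g₁ ^ q * g₂) : B ∣ g₁ := by
  letI := UniqueFactorizationMonoid.toGCDMonoid K[X]
  obtain ⟨B', g', eB, eg, hu⟩ := extract_gcd B g₁
  have hcop : IsCoprime B' g' := (gcd_isUnit_iff _ _).1 hu
  generalize gcd B g₁ = d at eB eg
  have hd0 : d ≠ 0 := by rintro rfl; apply hB; rw [eB, zero_mul]
  have hB'0 : B' ≠ 0 := by rintro rfl; apply hB; rw [eB, mul_zero]
  rw [eB, eg, mul_pow, mul_pow, mul_assoc] at h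
  have h1 := (mul_dvd_mul_iff_left (pow_ne_zero q hd0)).1 h
  have h2 : B' ^ q ∣ g₂ := (hcop.pow (m := q) (n := q)).dvd_of_dvd_mul_left h1
  have h3 : B'.natDegree = 0 := by
    by_contra h0
    exact hqfree ⟨B', Nat.pos_of_ne_zero h0, h2⟩
  have h4 : IsUnit B' := by
    rw [isUnit_iff_degree_eq_zero, degree_eq_natDegree hB'0, h3]; rfl
  rw [eB, eg, h4.mul_right_dvd]
  exact dvd_mul_right _ _

theorem deg_img {q : ℕ} (hq : 2 ≤ q) {g₁ g₂ ρ : K[X]} (h1 : g₁ ≠ 0) (h2 : g₂ ≠ 0) (hρ : ρ.degree < g₁.degree) :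
    (g₂ * (ρ ^ q - ρ * g₁ ^ (q - 1))).degree < (g₁ ^ q * g₂).degree := by
  rw [mul_comm, degree_mul, degree_mul]
  refine WithBot.add_lt_add_right (degree_ne_bot.2 h2) ?_
  obtain ⟨k, rfl⟩ : ∃ k, q = k + 1 := ⟨q - 1, by omega⟩
  by_cases h0 : ρ = 0
  · rw [h0, zero_pow (by omega), zero_mul, sub_zero, degree_zero]
    exact bot_lt_iff_ne_bot.2 (degree_ne_bot.2 (pow_ne_zero _ h1))
  have hn := natDegree_lt_natDegree h0 hρ
  rw [Nat.add_sub_cancel]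
  refine (degree_sub_le _ _).trans_lt (max_lt ?_ ?_)
  · apply degree_lt_degree
    rw [natDegree_pow, natDegree_pow]
    exact Nat.mul_lt_mul_of_pos_left hn (by omega)
  · apply degree_lt_degree
    rw [natDegree_mul h0 (pow_ne_zero _ h1), natDegree_pow, natDegree_pow, Nat.succ_mul]
    omega

theorem inj_img {q : ℕ} (hq : 2 ≤ q) {g₁ g₂ ρ : K[X]} (h2 : g₂ ≠ 0) (hρ : ρ.degree < g₁.degree)
    (h : g₂ * (ρ ^ q - ρ * g₁ ^ (q - 1)) = 0) : ρ = 0 := by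
  by_contra h0
  have hn := natDegree_lt_natDegree h0 hρ
  obtain ⟨k, rfl⟩ : ∃ k, q = k + 1 := ⟨q - 1, by omega⟩
  have h3 := sub_eq_zero.1 ((mul_eq_zero.1 h).resolve_left h2)
  rw [Nat.add_sub_cancel, pow_succ'] at h3
  have h4 := congrArg natDegree (mul_left_cancel₀ h0 h3)
  rw [natDegree_pow, natDegree_pow] at h4
  have := Nat.eq_of_mul_eq_mul_left (by omega : 0 < k) h4
  omega

theorem kernel_form {L : Type*} [Field L] [Algebra K[X] L] [IsFractionRing K[X] L] (p r : ℕ) [Fact p.Prime]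
    [CharP K p] (hr : 1 ≤ r) {g g₁ g₂ h : K[X]} (hg0 : g ≠ 0) (hfact : g = g₁ ^ p ^ r * g₂)
    (hqfree : ¬ ∃ w : K[X], 0 < w.natDegree ∧ w ^ p ^ r ∣ g₂) (hd : h.degree < g.degree) (v : L)
    (hv : v ^ p ^ r - v = algebraMap K[X] L h / algebraMap K[X] L g) :
    ∃ ρ : K[X], ρ.degree < g₁.degree ∧ h = g₂ * (ρ ^ p ^ r - ρ * g₁ ^ (p ^ r - 1)) := by
  have hp := Fact.out (p := p.Prime)
  have hq : 2 ≤ p ^ r := hp.two_le.trans (Nat.le_self_pow (by omega) p)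
  have hinj := IsFractionRing.injective K[X] L
  have hne : ∀ w : K[X], w ≠ 0 → algebraMap K[X] L w ≠ 0 := fun w hw => by
    rwa [Ne, map_eq_zero_iff _ hinj]
  have hg₂0 : g₂ ≠ 0 := by rintro rfl; apply hg0; rw [hfact, mul_zero]
  have hg₁0 : g₁ ≠ 0 := by
    rintro rfl; apply hg0; rw [hfact, zero_pow (by omega), zero_mul]
  obtain ⟨A, ⟨B, hB⟩, hrel, hAB⟩ := IsFractionRing.exists_reduced_fraction (A := K[X]) v
  have hB0 : B ≠ 0 := nonZeroDivisors.ne_zero hB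
  have hcop : IsCoprime A B := hrel.isCoprime
  rw [IsFractionRing.mk'_eq_div] at hAB
  obtain ⟨k, hk⟩ : ∃ k, p ^ r = k + 2 := ⟨p ^ r - 2, by omega⟩
  have h1 : (A ^ p ^ r - A * B ^ (p ^ r - 1)) * g = h * B ^ p ^ r := by
    apply hinj
    rw [← hAB] at hv
    have hB' := hne B hB0
    have hg' := hne g hg0
    simp only [map_mul, map_sub, map_pow]
    simp only at hv
    rw [div_pow, hk, div_sub_div _ _ (pow_ne_zero _ hB') hB',
      div_eq_div_iff (mul_ne_zero (pow_ne_zero _ hB') hB') hg'] at hv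
    rw [hk, show k + 2 - 1 = k + 1 by omega]
    apply mul_right_cancel₀ hB'
    linear_combination hv
  have h2 : B ^ p ^ r ∣ g := by
    have h3 : IsCoprime (B ^ p ^ r) (A ^ p ^ r - A * B ^ (p ^ r - 1)) := by
      apply IsCoprime.pow_left
      have h4 : A ^ p ^ r - A * B ^ (p ^ r - 1) = A ^ p ^ r + B * (- A * B ^ k) := by
        rw [hk, show k + 2 - 1 = k + 1 by omega]; ring
      rw [h4]
      exact (hcop.symm.pow_right).add_mul_left_right _
    exact h3.dvd_of_dvd_mul_left (h1 ▸ dvd_mul_left _ _)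
  rw [hfact] at h2
  obtain ⟨w, hw⟩ := dvd_of_pow_dvd_qfree hB0 hqfree h2
  have hw0 : w ≠ 0 := by rintro rfl; apply hg₁0; rw [hw, mul_zero]
  have h5 : h = g₂ * ((A * w) ^ p ^ r - (A * w) * g₁ ^ (p ^ r - 1)) := by
    apply mul_right_cancel₀ (pow_ne_zero (p ^ r) hB0)
    rw [← h1, hfact, hk, show k + 2 - 1 = k + 1 by omega, hw]
    ring
  set t := A * w / g₁ with ht
  set ρ := A * w % g₁ with hρ
  have hdm : A * w = g₁ * t + ρ := (EuclideanDomain.div_add_mod _ _).symm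
  have hρd : ρ.degree < g₁.degree := EuclideanDomain.mod_lt _ hg₁0
  have h6 : h = g₂ * (ρ ^ p ^ r - ρ * g₁ ^ (p ^ r - 1)) + g * (t ^ p ^ r - t) := by
    rw [h5, hdm, add_pow_char_pow, hfact, hk, show k + 2 - 1 = k + 1 by omega]
    ring
  refine ⟨ρ, hρd, ?_⟩
  have h7 : (g * (t ^ p ^ r - t)).degree < g.degree := by
    have : g * (t ^ p ^ r - t) = h - g₂ * (ρ ^ p ^ r - ρ * g₁ ^ (p ^ r - 1)) := by rw [h6]; ring
    rw [this]
    refine (degree_sub_le _ _).trans_lt (max_lt hd ?_)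
    rw [hfact]
    exact deg_img hq hg₁0 hg₂0 hρd
  have h8 : t ^ p ^ r - t = 0 := by
    by_contra h0
    exact absurd h7 (not_lt.2 (degree_le_mul_left g h0))
  rw [h8, mul_zero, add_zero] at h6
  exact h6

end assembly

end Part10


/-- Dimension of the trace of the Goppa-type AG code with divisor
`G = (g)₀ − P_∞` on the projective line: for `g ∈ 𝔽_{q^m}[z]` nonconstant with no zeros in
`𝔽_{q^m}`, `s` distinct zeros in an algebraic closure, `g = g₁^q g₂` with `g₂` `q`-th power
free, and `(deg g + 2s − 2)·√(q^m) < q^m + 1`, the code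
`{ (Tr(h(x)/g(x)))_{x ∈ 𝔽_{q^m}} : deg h < deg g }` is an `𝔽_q`-subspace of `𝔽_q^{q^m}` of
dimension `m((q−1)r₁ + r₂)`. -/
theorem stmt_1 (p r m : ℕ) (hp : p.Prime) (hr : 1 ≤ r) (hm : 2 ≤ m)
    (F K : Type) [Field F] [Field K] [Algebra F K] [Fintype F] [Fintype K]
    (hF : Fintype.card F = p ^ r) (hK : Fintype.card K = (p ^ r) ^ m)
    (g g₁ g₂ : K[X]) (hg : 0 < g.natDegree)
    (hnozero : ∀ x : K, g.eval x ≠ 0)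
    (s : ℕ)
    (hs : s = {x : AlgebraicClosure K | Polynomial.aeval x g = 0}.ncard)
    (hfact : g = g₁ ^ p ^ r * g₂)
    (hqfree : ¬ ∃ w : K[X], 0 < w.natDegree ∧ w ^ p ^ r ∣ g₂)
    (r₁ r₂ : ℕ) (hr₁ : g₁.natDegree = r₁) (hr₂ : g₂.natDegree = r₂)
    (hbound : ((g.natDegree : ℝ) + 2 * s - 2) * Real.sqrt (((p : ℝ) ^ r) ^ m)
      < ((p : ℝ) ^ r) ^ m + 1) :
    ∃ W : Submodule F (K → F),
      (W : Set (K → F)) =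
        {v : K → F | ∃ h : K[X], h.degree < g.degree ∧
          ∀ x : K, v x = Algebra.trace F K (h.eval x / g.eval x)} ∧
      Module.finrank F W = m * ((p ^ r - 1) * r₁ + r₂) := by
  classical
  have hpF : Fact p.Prime := ⟨hp⟩
  have hcF : CharP F p := by
    obtain ⟨p', hp'⟩ := CharP.exists F
    obtain ⟨n, hn', hn⟩ := FiniteField.card F p'
    have h1 : p' ∣ p ^ r := by rw [← hF, hn]; exact dvd_pow_self _ n.pos.ne'
    have h2 : p' = p := (Nat.prime_dvd_prime_iff_eq hn' hp).1 (hn'.dvd_of_dvd_pow h1)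
    rwa [h2] at hp'
  have hcK : CharP K p := charP_of_injective_algebraMap (algebraMap F K).injective p
  let _ : Algebra (ZMod p) F := ZMod.algebra F p
  let _ : Algebra (ZMod p) K := ZMod.algebra K p
  have hst : IsScalarTower (ZMod p) F K := IsScalarTower.of_algebraMap_eq' (Subsingleton.elim _ _)
  have hfin : Module.finrank F K = m := by
    have h1 := Module.card_eq_pow_finrank (K := F) (V := K)
    rw [hK, hF] at h1
    exact (Nat.pow_right_injective (hp.two_le.trans (Nat.le_self_pow (by omega) p)) h1).symm
  have hq : 2 ≤ p ^ r := hp.two_le.trans (Nat.le_self_pow (by omega) p)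
  have hg0 : g ≠ 0 := by rintro rfl; simp at hg
  have hg₂0 : g₂ ≠ 0 := by rintro rfl; apply hg0; rw [hfact, mul_zero]
  have hg₁0 : g₁ ≠ 0 := by
    rintro rfl; apply hg0; rw [hfact, zero_pow (by omega), zero_mul]
  have hdeg : g.natDegree = p ^ r * r₁ + r₂ := by
    rw [hfact, natDegree_mul (pow_ne_zero _ hg₁0) hg₂0, natDegree_pow, hr₁, hr₂]
  have hdg : g.degree = (g.natDegree : WithBot ℕ) := degree_eq_natDegree hg0
  have hdg₁ : g₁.degree = (r₁ : WithBot ℕ) := by rw [degree_eq_natDegree hg₁0, hr₁]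
  have hz₁ : ∀ x : K, g₁.eval x ≠ 0 := fun x hx => hnozero x (by
    rw [hfact, eval_mul, eval_pow, hx, zero_pow (by omega), zero_mul])
  have hz₂ : ∀ x : K, g₂.eval x ≠ 0 := fun x hx => hnozero x (by
    rw [hfact, eval_mul, hx, mul_zero])
  have hb : ((g.natDegree : ℝ) + 2 * ({x : AlgebraicClosure K | aeval x g = 0}.ncard : ℝ) - 2) *
      Real.sqrt (Fintype.card K) < Fintype.card K + 1 := by
    rw [← hs, hK]; push_cast; exact hbound
  have hfinD : ∀ n, Module.finrank F (degreeLT K n) = m * n := by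
    intro n
    have h1 := LinearEquiv.finrank_eq ((degreeLTEquiv K n).restrictScalars F)
    rw [h1, Module.finrank_pi_fintype]
    simp [hfin, mul_comm]
  have hfinM : ∀ n, Module.Finite F (degreeLT K n) := fun n =>
    Module.Finite.equiv ((degreeLTEquiv K n).restrictScalars F).symm
  have := hfinM g.natDegree
  have hco : ∀ (n : ℕ) (c : F) (a : degreeLT K n), ((c • a : degreeLT K n) : K[X]) = c • (a : K[X]) :=
    fun _ _ _ => rfl
  let T : degreeLT K g.natDegree →ₗ[F] (K → F) :=
    { toFun := fun h x => Algebra.trace F K ((h : K[X]).eval x / g.eval x)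
      map_add' := by
        intro a b; funext x
        simp [add_div]
      map_smul' := by
        intro c a; funext x
        simp only [RingHom.id_apply, Pi.smul_apply, hco]
        rw [← map_smul, ← algebraMap_smul K c (a : K[X]), eval_smul, algebraMap_smul, smul_div_assoc] }
  have hmemq : ∀ a : degreeLT K r₁, g₂ * ((a : K[X]) ^ p ^ r - (a : K[X]) * g₁ ^ (p ^ r - 1)) ∈
      degreeLT K g.natDegree := by
    intro a
    rw [mem_degreeLT, ← hdg, hfact]
    exact deg_img hq hg₁0 hg₂0 (by rw [hdg₁]; exact mem_degreeLT.1 a.2)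
  let S : degreeLT K r₁ →ₗ[F] degreeLT K g.natDegree :=
    { toFun := fun a => ⟨_, hmemq a⟩
      map_add' := by
        intro a b
        apply Subtype.ext
        simp only [Submodule.coe_add]
        rw [add_pow_char_pow]
        ring
      map_smul' := by
        intro c a
        apply Subtype.ext
        simp only [RingHom.id_apply, hco]
        rw [_root_.smul_pow, ← hF, FiniteField.pow_card, smul_mul_assoc, ← smul_sub, mul_smul_comm] }
  have hSinj : Function.Injective S := by
    rw [← LinearMap.ker_eq_bot, LinearMap.ker_eq_bot']
    intro a ha
    apply Subtype.ext
    exact inj_img hq hg₂0 (by rw [hdg₁]; exact mem_degreeLT.1 a.2) (congrArg Subtype.val ha)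
  have hker : LinearMap.ker T = LinearMap.range S := by
    ext ⟨h, hh⟩
    have hh' : h.degree < g.degree := by rw [hdg]; exact mem_degreeLT.1 hh
    rw [LinearMap.mem_ker, LinearMap.mem_range]
    constructor
    · intro hT
      have hT' : ∀ x, Algebra.trace F K (h.eval x / g.eval x) = 0 := fun x => congrFun hT x
      have hchL : CharP (FractionRing K[X]) p :=
        charP_of_injective_algebraMap (IsFractionRing.injective K[X] (FractionRing K[X])) p
      obtain ⟨v, hv⟩ := exists_q_root p r hr hF
        (((algebraMap K[X] (FractionRing K[X])).comp C).comp (algebraMap F K))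
        (algebraMap K[X] (FractionRing K[X]) h / algebraMap K[X] (FractionRing K[X]) g) (by
          intro c
          obtain ⟨u, hu⟩ := reduce_core (p := p) (L := FractionRing K[X]) hg0 hnozero hb g.natDegree
            (C (algebraMap F K c) * h) g le_rfl dvd_rfl
            (by
              rw [← smul_eq_C_mul]
              exact (degree_smul_le _ _).trans_lt hh') (by
              intro x
              rw [eval_mul, eval_C, mul_div_assoc, ← Algebra.smul_def,
                ← Algebra.trace_trace (S := F), map_smul, hT' x, smul_zero, map_zero])
          refine ⟨u, ?_⟩
          rw [← hu, map_mul, mul_div_assoc]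
          rfl)
      obtain ⟨ρ, hρ, hρh⟩ := kernel_form p r hr hg0 hfact hqfree hh' v hv
      refine ⟨⟨ρ, mem_degreeLT.2 (by rw [← hdg₁]; exact hρ)⟩, ?_⟩
      exact Subtype.ext hρh.symm
    · rintro ⟨a, ha⟩
      have ha' : g₂ * ((a : K[X]) ^ p ^ r - (a : K[X]) * g₁ ^ (p ^ r - 1)) = h := congrArg Subtype.val ha
      funext x
      change Algebra.trace F K (h.eval x / g.eval x) = 0
      obtain ⟨k, hk⟩ : ∃ k, p ^ r = k + 1 := ⟨p ^ r - 1, by omega⟩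
      have h1 : h.eval x / g.eval x = ((a : K[X]).eval x / g₁.eval x) ^ p ^ r - (a : K[X]).eval x / g₁.eval x := by
        have e1 := hz₁ x
        have e2 := hz₂ x
        rw [← ha', hfact, div_pow]
        simp only [eval_mul, eval_sub, eval_pow]
        rw [hk, Nat.add_sub_cancel]
        field_simp
        ring
      rw [h1, map_sub, sub_eq_zero, ← hF]
      have h2 := Algebra.trace_eq_of_algEquiv (FiniteField.frobeniusAlgEquivOfAlgebraic F K)
        ((a : K[X]).eval x / g₁.eval x)
      simpa [div_pow] using h2
  refine ⟨LinearMap.range T, ?_, ?_⟩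
  · ext v
    simp only [SetLike.mem_coe, LinearMap.mem_range, Set.mem_ofPred_eq]
    constructor
    · rintro ⟨h, rfl⟩
      exact ⟨h, by rw [hdg]; exact mem_degreeLT.1 h.2, fun x => rfl⟩
    · rintro ⟨h, hh, hv⟩
      exact ⟨⟨h, mem_degreeLT.2 (by rw [← hdg]; exact hh)⟩, funext fun x => (hv x).symm⟩
  · have h1 := LinearMap.finrank_range_add_finrank_ker T
    rw [hker, LinearMap.finrank_range_of_inj hSinj, hfinD, hfinD] at h1
    have h3 : m * g.natDegree = m * (p ^ r * r₁ + r₂) := by rw [← hdeg]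
    rw [h3] at h1
    obtain ⟨k, hk⟩ : ∃ k, p ^ r = k + 1 := ⟨p ^ r - 1, by omega⟩
    rw [hk] at h1 ⊢
    rw [Nat.add_sub_cancel]
    have h2 : m * ((k + 1) * r₁ + r₂) = m * (k * r₁ + r₂) + m * r₁ := by ring
    omega
end

section
/- Let p be a prime, q = p^r with r ≥ 1, and let R be a commutative 𝔽_q-algebra. Then for every y ∈ 𝔽_q and every h ∈ R, one has y·(h^q − h) = w^p − w, where w = Σ_{i=0}^{r−1} (y·h)^{p^i}. In particular, every element of R of the form y·(h^q − h) with y ∈ 𝔽_q is of the form w^p − w for some w ∈ R. -/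
/-- If `q = p^r` and `R` is a commutative `𝔽_q`-algebra, then for `y ∈ 𝔽_q`
and `h ∈ R` one has `y·(h^q − h) = w^p − w` where `w = ∑_{i=0}^{r−1} (y·h)^{p^i}`. -/
theorem stmt_3 (p r : ℕ) (hp : p.Prime) (hr : 1 ≤ r)
    (F : Type) [Field F] [Fintype F] (hF : Fintype.card F = p ^ r)
    (R : Type) [CommRing R] [Algebra F R] (y : F) (h : R) :
    y • (h ^ p ^ r - h) =
      (∑ i ∈ Finset.range r, (y • h) ^ p ^ i) ^ p -
        ∑ i ∈ Finset.range r, (y • h) ^ p ^ i := by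
  have : Fact p.Prime := ⟨hp⟩
  have : CharP F p := charP_of_card_eq_prime_pow hF
  rcases subsingleton_or_nontrivial R with hR | hR
  · exact Subsingleton.elim _ _
  have : CharP R p := charP_of_injective_algebraMap (algebraMap F R).injective p
  have hy : y ^ p ^ r = y := by rw [← hF]; exact FiniteField.pow_card y
  rw [sum_pow_char, ← Finset.sum_sub_distrib]
  have e : ∀ i ∈ Finset.range r, ((y • h) ^ p ^ i) ^ p - (y • h) ^ p ^ i
      = (fun j => (y • h) ^ p ^ j) (i + 1) - (fun j => (y • h) ^ p ^ j) i := by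
    intro i _
    simp only [← pow_mul, ← pow_succ]
  rw [Finset.sum_congr rfl e, Finset.sum_range_sub (fun j => (y • h) ^ p ^ j)]
  simp only [pow_zero, pow_one]
  rw [smul_pow, hy, smul_sub]
end

section
/- Let p be a prime, q = p^r with r ≥ 1, m ≥ 2, let 𝔽_{q^m} be the finite field with q^m elements, let 𝔽̄ be an algebraic closure of 𝔽_{q^m}, and view the rational function field 𝔽_{q^m}(z) as a subfield of 𝔽̄(z). Then for f ∈ 𝔽_{q^m}(z) the following are equivalent: (i) there exists h ∈ 𝔽̄(z) with f = h^p − h; (ii) there exist h₁ ∈ 𝔽_{q^m}(z) and c ∈ 𝔽_{q^m} with f = h₁^p − h₁ + c. -/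
open Polynomial

/-- The natural embedding `RatFunc K →+* RatFunc L` induced by a field embedding `K →+* L`. -/
noncomputable def ratFuncMap {K L : Type} [Field K] [Field L] (φ : K →+* L) :
    RatFunc K →+* RatFunc L :=
  RatFunc.mapRingHom (Polynomial.mapRingHom φ) (by
    intro q hq
    simp only [Submonoid.mem_comap, coe_mapRingHom]
    rw [mem_nonZeroDivisors_iff_ne_zero] at hq ⊢
    exact (Polynomial.map_ne_zero_iff φ.injective).mpr hq)

theorem aux_fixed {F A : Type} [Field F] [Fintype F] [Field A] (φ : F →+* A) (x : A)
    (hx : x ^ Fintype.card F = x) : ∃ a, φ a = x := by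
  have h1 : (X ^ Fintype.card F - X : F[X]) = (Finset.univ.val.map fun a : F => X - C a).prod := by
    rw [← FiniteField.roots_X_pow_card_sub_X F]
    have hm : (X ^ Fintype.card F - X : F[X]).Monic :=
      monic_X_pow_sub (by rw [degree_X]; exact_mod_cast Fintype.one_lt_card)
    refine (prod_multiset_X_sub_C_of_monic_of_roots_card_eq hm ?_).symm
    rw [FiniteField.roots_X_pow_card_sub_X, FiniteField.X_pow_card_sub_X_natDegree_eq F Fintype.one_lt_card]
    rfl
  have h2 := congrArg (eval₂ φ x) h1
  have h3 : (Finset.univ.val.map fun a : F => X - C a).prod = ∏ a : F, (X - C a) := rfl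
  rw [h3, eval₂_finsetProd] at h2
  simp only [eval₂_sub, eval₂_pow, eval₂_X, hx, sub_self, eval₂_C] at h2
  obtain ⟨a, -, ha⟩ := Finset.prod_eq_zero_iff.mp h2.symm
  exact ⟨a, (sub_eq_zero.mp ha).symm⟩

theorem aux_div {K L : Type} [Field K] [Field L] (φ : K →+* L) (a b : K[X]) :
    ratFuncMap φ (algebraMap _ _ a / algebraMap _ _ b) =
      algebraMap _ _ (a.map φ) / algebraMap _ _ (b.map φ) := by
  unfold ratFuncMap
  rw [RatFunc.coe_mapRingHom_eq_coe_map, RatFunc.map_apply_div]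
  rfl

theorem aux_C {K L : Type} [Field K] [Field L] (φ : K →+* L) (a : K) :
    ratFuncMap φ (RatFunc.C a) = RatFunc.C (φ a) := by
  have := aux_div φ (C a) 1
  simpa using this

theorem aux_descent {K L : Type} [Field K] [Field L] (φ : K →+* L) (σ : L →+* L)
    (hσ : ∀ x, σ x = x → ∃ a, φ a = x) (g : RatFunc L) (hg : ratFuncMap σ g = g) :
    ∃ g₀, ratFuncMap φ g₀ = g := by
  have hd := RatFunc.denom_ne_zero g
  have hd' : (g.denom.map σ) ≠ 0 := (Polynomial.map_ne_zero_iff σ.injective).mpr hd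
  have h1 : g.num.map σ * g.denom = g.num * g.denom.map σ := by
    have h := aux_div σ g.num g.denom
    rw [RatFunc.num_div_denom, hg] at h
    nth_rw 1 [← RatFunc.num_div_denom g] at h
    rw [div_eq_div_iff (by simpa using hd) (by
      exact (map_ne_zero_iff _ (RatFunc.algebraMap_injective L)).mpr hd'),
      ← map_mul, ← map_mul] at h
    exact (RatFunc.algebraMap_injective L h).symm
  have h2 : g.denom ∣ g.denom.map σ :=
    (RatFunc.isCoprime_num_denom g).symm.dvd_of_dvd_mul_left (h1 ▸ dvd_mul_left _ _)
  have h3 : g.denom = g.denom.map σ := by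
    apply eq_of_dvd_of_natDegree_le_of_leadingCoeff h2
    · simp
    · rw [((RatFunc.monic_denom g).map σ).leadingCoeff, (RatFunc.monic_denom g).leadingCoeff]
  have h4 : g.num.map σ = g.num := by
    rw [← h3] at h1
    exact mul_right_cancel₀ hd h1
  have key : ∀ P : L[X], P.map σ = P → ∃ Q : K[X], Q.map φ = P := by
    intro P hP
    rw [← mem_lifts, lifts_iff_coeff_lifts]
    intro n
    exact hσ _ (by rw [← coeff_map, hP])
  obtain ⟨N, hN⟩ := key _ h4
  obtain ⟨D, hD⟩ := key _ h3.symm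
  refine ⟨algebraMap _ _ N / algebraMap _ _ D, ?_⟩
  rw [aux_div, hN, hD, RatFunc.num_div_denom]

theorem aux_comp {K L : Type} [Field K] [Field L] (φ : K →+* L) (σ : L →+* L)
    (hσ : ∀ a, σ (φ a) = φ a) (f : RatFunc K) :
    ratFuncMap σ (ratFuncMap φ f) = ratFuncMap φ f := by
  rw [← RatFunc.num_div_denom f, aux_div, aux_div, Polynomial.map_map, Polynomial.map_map]
  have : σ.comp φ = φ := RingHom.ext hσ
  rw [this]

theorem aux_AS {L : Type} [Field L] [IsAlgClosed L] (n : ℕ) (hn : 1 < n) (e : L) :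
    ∃ b : L, b ^ n - b = e := by
  have hdeg : (X ^ n - (X + C e) : L[X]).degree = n := by
    rw [degree_sub_eq_left_of_degree_lt, degree_X_pow]
    rw [degree_X_add_C, degree_X_pow]; exact_mod_cast hn
  obtain ⟨b, hb⟩ := IsAlgClosed.exists_root (X ^ n - (X + C e) : L[X]) (by
    rw [hdeg]; exact_mod_cast (by omega : n ≠ 0))
  refine ⟨b, ?_⟩
  simp only [IsRoot.def, eval_sub, eval_pow, eval_X, eval_add, eval_C] at hb
  linear_combination hb

/-- For `f ∈ 𝔽_{q^m}(z)`, `f = h^p − h` with `h ∈ 𝔽̄(z)` iff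
`f = h₁^p − h₁ + c` with `h₁ ∈ 𝔽_{q^m}(z)` and `c ∈ 𝔽_{q^m}`. -/
theorem stmt_4 (p r m : ℕ) (hp : p.Prime) (hr : 1 ≤ r) (hm : 2 ≤ m)
    (K : Type) [Field K] [Fintype K] (hK : Fintype.card K = (p ^ r) ^ m)
    (f : RatFunc K) :
    (∃ h : RatFunc (AlgebraicClosure K),
        ratFuncMap (algebraMap K (AlgebraicClosure K)) f = h ^ p - h) ↔
      (∃ (h₁ : RatFunc K) (c : K), f = h₁ ^ p - h₁ + RatFunc.C c) := by
  have hp1 := hp.one_lt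
  have : Fact p.Prime := ⟨hp⟩
  have hcard : Fintype.card K = p ^ (r * m) := by rw [hK, pow_mul]
  have hchar : CharP K p := by
    obtain ⟨l, hl⟩ := CharP.exists K
    have h0 : (p : K) = 0 := by
      have : ((Fintype.card K : ℕ) : K) = 0 := FiniteField.cast_card_eq_zero K
      rw [hcard, Nat.cast_pow] at this
      exact eq_zero_of_pow_eq_zero this
    have h1 : l ∣ p := (CharP.cast_eq_zero_iff K l p).mp h0
    rcases (Nat.dvd_prime hp).mp h1 with h | h
    · exact absurd h (CharP.char_ne_one K l)
    · exact h ▸ hl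
  set L := AlgebraicClosure K with hL
  have : CharP L p := charP_of_injective_algebraMap (algebraMap K L).injective p
  have : CharP (RatFunc L) p :=
    charP_of_injective_ringHom (RatFunc.C (K := L)).injective p
  set φ := algebraMap K L with hφ
  constructor
  · rintro ⟨h, hh⟩
    let σ : L →+* L := iterateFrobenius L p (r * m)
    have hσ : ∀ x, σ x = x ^ Fintype.card K := fun x => by
      rw [hcard]; exact iterateFrobenius_def ..
    have hσφ : ∀ a, σ (φ a) = φ a := fun a => by
      rw [hσ, ← map_pow, FiniteField.pow_card]
    have hfix : ∀ x, σ x = x → ∃ a, φ a = x := fun x hx =>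
      aux_fixed φ x (by rw [← hσ, hx])
    have h1 : (ratFuncMap σ h) ^ p - ratFuncMap σ h = h ^ p - h := by
      rw [← map_pow, ← map_sub, ← hh, aux_comp φ σ hσφ]
    have h2 : (ratFuncMap σ h - h) ^ p = ratFuncMap σ h - h := by
      rw [sub_pow_char]
      linear_combination h1
    obtain ⟨e, he⟩ := aux_fixed (ZMod.castHom dvd_rfl (RatFunc L) : ZMod p →+* RatFunc L) _
      (by rw [ZMod.card]; exact h2)
    obtain ⟨e', he', hep⟩ : ∃ e' : L, RatFunc.C e' = ratFuncMap σ h - h ∧ e' ^ p = e' := by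
      refine ⟨(ZMod.castHom dvd_rfl L : ZMod p →+* L) e, ?_, ?_⟩
      · rw [← he, ← RingHom.comp_apply]
        congr 1
        exact Subsingleton.elim _ _
      · rw [← map_pow, ZMod.pow_card]
    obtain ⟨b, hb⟩ := aux_AS (Fintype.card K) Fintype.one_lt_card (-e')
    rw [← hσ] at hb
    obtain ⟨g, hg⟩ := aux_descent φ σ hfix (h + RatFunc.C b) (by
      rw [map_add, aux_C, eq_add_of_sub_eq hb, map_add, map_neg, he']
      ring)
    obtain ⟨c, hc⟩ := hfix (b - b ^ p) (by
      have hb2 : σ b = b - e' := by linear_combination hb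
      rw [map_sub, map_pow, hb2, sub_pow_char, hep]
      ring)
    refine ⟨g, c, (ratFuncMap φ).injective ?_⟩
    rw [map_add, map_sub, map_pow, hg, aux_C, hc, hh, add_pow_char, map_sub, map_pow]
    ring
  · rintro ⟨g, c, rfl⟩
    obtain ⟨b, hb⟩ := aux_AS p hp1 (φ c)
    refine ⟨ratFuncMap φ g + RatFunc.C b, ?_⟩
    rw [map_add, map_sub, map_pow, aux_C, ← hb, add_pow_char, map_sub, map_pow]
    ring
end
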